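/- For every M > 0 and δ > 0 there exist η > 0 and Λ > 0 depending only on a, b, c, δ, M such that the following holds. Let ε ∈ (0,1), x ∈ ℝ³, and r ∈ (Λε, 1). If Q : B_{4r}(x) → S₀ is a smooth local minimizer of E_ε with sup_{B_{4r}(x)} |Q| ≤ M and r⁻¹ E_ε(Q, B_{2r}(x)) < η, then dist(Q(y), N) < δ for every y ∈ B_r(x), where dist(·,N) is the distance to the vacuum manifold N in the Frobenius norm. -/

import Mathlib

noncomputable section

open Matrix MeasureTheory Metric Set

attribute [local instance] Matrix.normedAddCommGroup Matrix.normedSpace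

abbrev E3 : Type := EuclideanSpace ℝ (Fin 3)
abbrev M3 : Type := Matrix (Fin 3) (Fin 3) ℝ

/-- The space of symmetric traceless real 3×3 matrices. -/
def S0 : Set M3 := {Q | Q.IsSymm ∧ Q.trace = 0}

def sstar (a b c : ℝ) : ℝ := (b + Real.sqrt (b ^ 2 + 24 * a * c)) / (4 * c)

def kconst (a b c : ℝ) : ℝ :=
  sstar a b c ^ 2 / 27 * (9 * a + 2 * b * sstar a b c - 3 * c * sstar a b c ^ 2)

/-- Bulk potential. -/
def fbulk (a b c : ℝ) (Q : M3) : ℝ :=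
  kconst a b c - a / 2 * (Q * Q).trace - b / 3 * (Q * Q * Q).trace
    + c / 4 * ((Q * Q).trace) ^ 2

/-- Partial derivative `∂ₖ Q` (componentwise). -/
def pd (Q : E3 → M3) (k : Fin 3) (x : E3) : M3 :=
  Matrix.of fun i j => fderiv ℝ (fun y => Q y i j) x (EuclideanSpace.single k 1)

/-- Squared Frobenius norm of a matrix. -/
def frobSq (A : M3) : ℝ := ∑ i, ∑ j, (A i j) ^ 2

def frobNorm (A : M3) : ℝ := Real.sqrt (frobSq A)

/-- `|∇Q|²`. -/
def gradSq (Q : E3 → M3) (x : E3) : ℝ := ∑ k : Fin 3, frobSq (pd Q k x)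

/-- Energy density `e_ε(Q)`. -/
def eDen (a b c ε : ℝ) (Q : E3 → M3) (x : E3) : ℝ :=
  1 / 2 * gradSq Q x + 1 / ε ^ 2 * fbulk a b c (Q x)

/-- Energy `E_ε(Q, U)`. -/
def energy (a b c ε : ℝ) (Q : E3 → M3) (U : Set E3) : ℝ :=
  ∫ x in U, eDen a b c ε Q x

/-- Componentwise Laplacian. -/
def lapM (Q : E3 → M3) (x : E3) : M3 :=
  ∑ k : Fin 3, Matrix.of fun i j =>
    fderiv ℝ (fun y => pd Q k y i j) x (EuclideanSpace.single k 1)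

/-- `|Q|² = tr(Q²)`. -/
def normSqM (Q : M3) : ℝ := (Q * Q).trace

/-- The Euler–Lagrange equation at a point. -/
def ELeq (a b c ε : ℝ) (Q : E3 → M3) (x : E3) : Prop :=
  (-(ε ^ 2)) • lapM Q x - a • Q x - b • (Q x * Q x)
    + (b / 3 * normSqM (Q x)) • (1 : M3) + (c * normSqM (Q x)) • Q x = 0

/-- Local minimizer of the Landau–de Gennes energy on an open set `ω`. -/
def IsLDGMin (a b c ε : ℝ) (ω : Set E3) (Q : E3 → M3) : Prop :=
  ∀ (x : E3) (r : ℝ), 0 < r → closedBall x r ⊆ ω →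
    ∀ P : E3 → M3, ContDiffOn ℝ (⊤ : ℕ∞) P ω → (∀ y ∈ ω, P y ∈ S0) →
      (∃ K : Set E3, IsCompact K ∧ K ⊆ ball x r ∧ ∀ y ∉ K, P y = Q y) →
      energy a b c ε Q (ball x r) ≤ energy a b c ε P (ball x r)

/-- The vacuum manifold `N`. -/
def Nman (a b c : ℝ) : Set M3 :=
  {P | ∃ n : Fin 3 → ℝ, (∑ i, (n i) ^ 2) = 1 ∧
    P = sstar a b c • (Matrix.vecMulVec n n - (1 / 3 : ℝ) • (1 : M3))}

/-- Frobenius distance to the vacuum manifold. -/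
def distN (a b c : ℝ) (Q : M3) : ℝ :=
  sInf ((fun P => frobNorm (Q - P)) '' Nman a b c)

/-- Directional derivative `v·∇Q = Σₖ vₖ ∂ₖQ`. -/
def dirD (Q : E3 → M3) (v : E3) (x : E3) : M3 := ∑ k : Fin 3, v k • pd Q k x

/-- Admissible cutoff profile. -/
def AdmissibleCutoff (φ : ℝ → ℝ) : Prop :=
  ContDiff ℝ (⊤ : ℕ∞) φ ∧ (∀ t, 0 ≤ φ t) ∧ (∀ t, 10 ≤ t → φ t = 0) ∧
    (∀ t ∈ Icc (0 : ℝ) 8, 1 ≤ φ t) ∧ φ 0 = 60 ∧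
    (∀ t, 0 ≤ t → |deriv φ t| ≤ 100) ∧
    (∀ t ∈ Icc (0 : ℝ) 8, deriv φ t ∈ Icc (-2 : ℝ) (-1)) ∧
    (∀ t, 0 ≤ t → deriv φ t ≤ 0)

/-- The density `Θ_ρ^φ(Q, x)`. -/
def Theta (a b c ε : ℝ) (φ : ℝ → ℝ) (Q : E3 → M3) (x : E3) (ρ : ℝ) : ℝ :=
  ρ⁻¹ * ∫ y in ball x (Real.sqrt 10 * ρ), eDen a b c ε Q y * φ (‖y - x‖ ^ 2 / ρ ^ 2)

/-- The regular scale `r(Q, x)`. -/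
def regScale (a b c ε : ℝ) (Q : E3 → M3) (x : E3) : ℝ :=
  sSup {ρ : ℝ | 0 ≤ ρ ∧ ρ ≤ 1 ∧ ∀ y ∈ ball x ρ, ρ ^ 2 * eDen a b c ε Q y ≤ 1}

/-- The bad set `Bad(Q; s, δ)`. -/
def badSet (a b c ε : ℝ) (Q : E3 → M3) (s δ : ℝ) : Set E3 :=
  {y | regScale a b c ε Q y < s} ∪ {y | δ < distN a b c (Q y)}


section

open Filter Topology

/-- Coordinate partial derivative. -/
def Dk (k : Fin 3) (f : E3 → ℝ) (x : E3) : ℝ := fderiv ℝ f x (EuclideanSpace.single k 1)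

theorem Dk_line {k : Fin 3} {f : E3 → ℝ} {x : E3} (hf : DifferentiableAt ℝ f x) :
    HasDerivAt (fun s : ℝ => f (x + s • EuclideanSpace.single k (1 : ℝ))) (Dk k f x) 0 :=
  hf.hasFDerivAt.hasLineDerivAt _

theorem Dk_line_at {k : Fin 3} {f : E3 → ℝ} {x : E3} {s : ℝ}
    (hf : DifferentiableAt ℝ f (x + s • EuclideanSpace.single k (1 : ℝ))) :
    HasDerivAt (fun s : ℝ => f (x + s • EuclideanSpace.single k (1 : ℝ)))
      (Dk k f (x + s • EuclideanSpace.single k (1 : ℝ))) s := by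
  have h1 : HasDerivAt (fun s : ℝ => x + s • EuclideanSpace.single k (1 : ℝ))
      (EuclideanSpace.single k (1 : ℝ)) s := by
    simpa using ((hasDerivAt_id s).smul_const (EuclideanSpace.single k (1 : ℝ))).const_add x
  exact hf.hasFDerivAt.comp_hasDerivAt s h1

theorem Dk_eq {k : Fin 3} {f : E3 → ℝ} {x : E3} {v : ℝ} (hf : DifferentiableAt ℝ f x)
    (h : HasDerivAt (fun s : ℝ => f (x + s • EuclideanSpace.single k (1 : ℝ))) v 0) :
    Dk k f x = v := (Dk_line hf).unique h

theorem coord_line (k i : Fin 3) (x : E3) :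
    HasDerivAt (fun s : ℝ => (x + s • EuclideanSpace.single k (1 : ℝ)) i)
      (if i = k then 1 else 0) 0 := by
  have : (fun s : ℝ => (x + s • EuclideanSpace.single k (1 : ℝ)) i)
      = fun s : ℝ => x i + s * (if i = k then 1 else 0) := by
    funext s; simp
  rw [this]
  simpa using ((hasDerivAt_id (0:ℝ)).mul_const (if i = k then (1:ℝ) else 0)).const_add (x i)

theorem contDiffOn_Dk {Ω : Set E3} (hΩ : IsOpen Ω) {f : E3 → ℝ} (k : Fin 3)
    {m n : WithTop ℕ∞} (hmn : m + 1 ≤ n) (hf : ContDiffOn ℝ n f Ω) :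
    ContDiffOn ℝ m (Dk k f) Ω :=
  (hf.fderiv_of_isOpen hΩ hmn).clm_apply contDiffOn_const

theorem Dk_symm {f : E3 → ℝ} {x : E3} (hf : ContDiffAt ℝ 2 f x) (i j : Fin 3) :
    Dk i (Dk j f) x = Dk j (Dk i f) x := by
  have h := hf.isSymmSndFDerivAt (by simp)
  have hd : DifferentiableAt ℝ (fderiv ℝ f) x :=
    (hf.fderiv_right (m := 1) (by norm_num)).differentiableAt (by norm_num)
  have key : ∀ i j : Fin 3, Dk i (Dk j f) x
      = fderiv ℝ (fderiv ℝ f) x (EuclideanSpace.single i 1) (EuclideanSpace.single j 1) := by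
    intro i j
    unfold Dk
    rw [fderiv_clm_apply hd (differentiableAt_const _)]
    simp
  rw [key, key, h.eq]

/-- Integral of a derivative of a compactly supported function vanishes. -/
theorem integral_Dk_zero {f : E3 → ℝ} (k : Fin 3) (hc : HasCompactSupport f)
    (hf : ContDiff ℝ 1 f) : Integrable (Dk k f) ∧ ∫ x, Dk k f x = 0 := by
  have hcont : Continuous (Dk k f) :=
    (hf.continuous_fderiv (by norm_num)).clm_apply continuous_const
  have hcs : HasCompactSupport (Dk k f) := by
    have := hc.fderiv_apply (𝕜 := ℝ) (EuclideanSpace.single k (1:ℝ))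
    exact this
  have hi : Integrable (Dk k f) := hcont.integrable_of_hasCompactSupport hcs
  refine ⟨hi, ?_⟩
  have h := integral_mul_fderiv_eq_neg_fderiv_mul_of_integrable (μ := (volume : Measure E3))
    (f := fun _ : E3 => (1:ℝ)) (g := f) (v := EuclideanSpace.single k (1:ℝ))
    (by simp) (by simpa [Dk] using (show Integrable (fun x => Dk k f x) from hi))
    (by simpa using hf.continuous.integrable_of_hasCompactSupport hc) (by simp)
    (fun x _ => hf.differentiable (by norm_num) x)
  simpa [Dk] using h

theorem cutoff_mul_contDiff {Ω : Set E3} (hΩ : IsOpen Ω) {G w : E3 → ℝ} {n : WithTop ℕ∞}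
    (hG : ContDiff ℝ n G) (hs : tsupport G ⊆ Ω) (hw : ContDiffOn ℝ n w Ω) :
    ContDiff ℝ n (fun y => G y * w y) := by
  rw [contDiff_iff_contDiffAt]
  intro x
  by_cases hx : x ∈ tsupport G
  · exact hG.contDiffAt.mul (hw.contDiffAt (hΩ.mem_nhds (hs hx)))
  · have h := notMem_tsupport_iff_eventuallyEq.1 hx
    have h2 : (fun y => G y * w y) =ᶠ[𝓝 x] fun _ => 0 := by
      filter_upwards [h] with y hy
      simp [hy]
    exact contDiffAt_const.congr_of_eventuallyEq h2

theorem integral_Dk_cutoff {Ω : Set E3} (hΩ : IsOpen Ω) {G w : E3 → ℝ} (k : Fin 3)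
    (hG : ContDiff ℝ 1 G) (hs : tsupport G ⊆ Ω) (hc : HasCompactSupport G)
    (hw : ContDiffOn ℝ 1 w Ω) :
    Integrable (Dk k (fun y => G y * w y)) ∧ ∫ x, Dk k (fun y => G y * w y) x = 0 :=
  integral_Dk_zero k hc.mul_right (cutoff_mul_contDiff hΩ hG hs hw)

theorem Dk_cutoff_zero {G w : E3 → ℝ} (k : Fin 3) {x : E3} (hx : x ∉ tsupport G) :
    Dk k (fun y => G y * w y) x = 0 := by
  have : (fun y => G y * w y) =ᶠ[𝓝 x] fun _ => 0 := by
    have h := notMem_tsupport_iff_eventuallyEq.1 hx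
    filter_upwards [h] with y hy
    simp [hy]
  unfold Dk
  rw [this.fderiv_eq]; simp

end

section

open Filter Topology

theorem psq_hasDerivAt (s : ℝ) : HasDerivAt (fun s : ℝ => (max 0 s) ^ 2) (2 * max 0 s) s := by
  rcases lt_trichotomy s 0 with h | h | h
  · have : (fun s : ℝ => (max 0 s) ^ 2) =ᶠ[𝓝 s] fun _ => 0 := by
      filter_upwards [Iio_mem_nhds h] with t ht
      simp [max_eq_left (le_of_lt (mem_Iio.1 ht))]
    rw [max_eq_left h.le]
    simpa using (hasDerivAt_const s (0:ℝ)).congr_of_eventuallyEq this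
  · subst h
    simp only [max_self, mul_zero]
    rw [hasDerivAt_iff_isLittleO]
    have h1 : (fun x' : ℝ => (max 0 x') ^ 2 - (max 0 (0:ℝ)) ^ 2 - (x' - 0) • (0:ℝ))
        =O[𝓝 0] fun x' : ℝ => x' ^ 2 := by
      refine Asymptotics.IsBigO.of_bound 1 (Eventually.of_forall fun x => ?_)
      simp only [max_self, smul_zero, sub_zero, one_mul, Real.norm_eq_abs, ne_eq, OfNat.ofNat_ne_zero,
        not_false_eq_true, zero_pow]
      rw [abs_of_nonneg (by positivity), abs_of_nonneg (by positivity)]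
      rcases le_total 0 x with hx | hx
      · rw [max_eq_right hx]
      · rw [max_eq_left hx]; nlinarith [sq_nonneg x]
    refine h1.trans_isLittleO ?_
    simpa using (Asymptotics.isLittleO_pow_id (𝕜 := ℝ) (n := 2) (by norm_num))
  · have : (fun s : ℝ => (max 0 s) ^ 2) =ᶠ[𝓝 s] fun s => s ^ 2 := by
      filter_upwards [Ioi_mem_nhds h] with t ht
      simp [max_eq_right (le_of_lt (mem_Ioi.1 ht))]
    rw [max_eq_right h.le]
    simpa using (hasDerivAt_pow 2 s).congr_of_eventuallyEq this

theorem psq_contDiff : ContDiff ℝ 1 (fun s : ℝ => (max 0 s) ^ 2) := by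
  rw [contDiff_one_iff_deriv]
  refine ⟨fun s => (psq_hasDerivAt s).differentiableAt, ?_⟩
  have : deriv (fun s : ℝ => (max 0 s) ^ 2) = fun s => 2 * max 0 s :=
    funext fun s => (psq_hasDerivAt s).deriv
  rw [this]; fun_prop

def sqd (z y : E3) : ℝ := ∑ i, (y i - z i) ^ 2

theorem sqd_eq (z y : E3) : sqd z y = dist y z ^ 2 := by
  rw [EuclideanSpace.dist_eq, Real.sq_sqrt (by positivity)]
  simp [sqd, Real.dist_eq]

theorem contDiff_sqd (z : E3) {n : WithTop ℕ∞} : ContDiff ℝ n (sqd z) := by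
  unfold sqd; fun_prop

theorem sqd_line (k : Fin 3) (z y : E3) :
    HasDerivAt (fun s : ℝ => sqd z (y + s • EuclideanSpace.single k (1 : ℝ)))
      (2 * (y k - z k)) 0 := by
  have h : ∀ i ∈ Finset.univ, HasDerivAt
      (fun s : ℝ => ((y + s • EuclideanSpace.single k (1 : ℝ)) i - z i) ^ 2)
      (2 * (y i - z i) * (if i = k then 1 else 0)) 0 := by
    intro i _
    have := ((coord_line k i y).sub_const (z i)).fun_pow 2
    simpa using this
  have h2 := HasDerivAt.fun_sum h
  simpa [sqd] using h2

theorem exists_cutoff (z : E3) (R ρ : ℝ) (hρ : 0 < ρ) (hR : 2 * ρ ≤ R) :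
    ∃ G H : E3 → ℝ, ContDiff ℝ 1 G ∧ tsupport G ⊆ closedBall z R ∧ (∀ y, 0 ≤ G y) ∧
      (∀ y, 0 ≤ H y) ∧ (∀ y i, Dk i G y = -H y * (y i - z i)) ∧
      (∀ y ∈ closedBall z R, -(4 / R) ≤ G y - H y * sqd z y) ∧
      (∀ y ∈ ball z ρ, 3 / (16 * ρ) - 4 / R ≤ G y - H y * sqd z y) := by
  have hR0 : 0 < R := by linarith
  have hT0 : ∀ y, 0 ≤ sqd z y := fun y => by unfold sqd; positivity
  set m : E3 → ℝ := fun y => max 0 (1 - sqd z y / R ^ 2) with hm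
  set w : E3 → ℝ := fun y => (Real.sqrt (sqd z y + ρ ^ 2))⁻¹ with hw
  have hS : ∀ y, 0 < Real.sqrt (sqd z y + ρ ^ 2) := fun y =>
    Real.sqrt_pos.2 (by have := hT0 y; positivity)
  have hw0 : ∀ y, 0 < w y := fun y => inv_pos.2 (hS y)
  have hm0 : ∀ y, 0 ≤ m y := fun y => le_max_left _ _
  have hm1 : ∀ y, m y ≤ 1 := fun y => max_le (by norm_num) (by
    have := hT0 y
    have : 0 ≤ sqd z y / R ^ 2 := by positivity
    linarith)
  have hw2 : ∀ y, w y ^ 2 * (sqd z y + ρ ^ 2) = 1 := by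
    intro y
    have h1 : Real.sqrt (sqd z y + ρ ^ 2) ^ 2 = sqd z y + ρ ^ 2 :=
      Real.sq_sqrt (by have := hT0 y; positivity)
    rw [← h1]; simp only [hw]
    rw [← mul_pow, inv_mul_cancel₀ (hS y).ne']; norm_num
  have hGc : ContDiff ℝ 1 (fun y => m y ^ 2 * w y) := by
    apply ContDiff.mul
    · exact psq_contDiff.comp (contDiff_const.sub ((contDiff_sqd z).div_const _))
    · apply ContDiff.inv
      · apply ContDiff.sqrt
        · exact (contDiff_sqd z).add contDiff_const
        · intro y; have := hT0 y; positivity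
      · intro y; exact (hS y).ne'
  have hident : ∀ y, m y ^ 2 * w y - (4 * m y / R ^ 2 * w y + m y ^ 2 * w y ^ 3) * sqd z y
      = m y ^ 2 * w y ^ 3 * ρ ^ 2 - 4 * m y * (w y * sqd z y) / R ^ 2 := by
    intro y
    have h := hw2 y
    have : m y ^ 2 * w y = m y ^ 2 * w y * (w y ^ 2 * (sqd z y + ρ ^ 2)) := by rw [h, mul_one]
    rw [this]; ring
  have hsecond : ∀ y ∈ closedBall z R, 4 * m y * (w y * sqd z y) / R ^ 2 ≤ 4 / R := by
    intro y hy
    have hd : dist y z ≤ R := hy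
    have hd0 : 0 ≤ dist y z := dist_nonneg
    have h1 : w y * dist y z ≤ 1 := by
      simp only [hw]
      rw [inv_mul_le_iff₀ (hS y), mul_one]
      apply Real.le_sqrt_of_sq_le
      rw [sqd_eq]; nlinarith [sq_nonneg ρ]
    have h2 : w y * sqd z y ≤ R := by
      rw [sqd_eq]; nlinarith [hw0 y]
    have h3 : m y * (w y * sqd z y) ≤ R := by
      have : 0 ≤ w y * sqd z y := mul_nonneg (hw0 y).le (hT0 y)
      nlinarith [hm0 y, hm1 y]
    rw [div_le_div_iff₀ (by positivity) hR0]
    nlinarith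
  refine ⟨fun y => m y ^ 2 * w y, fun y => 4 * m y / R ^ 2 * w y + m y ^ 2 * w y ^ 3,
    hGc, ?_, ?_, ?_, ?_, ?_, ?_⟩
  · apply closure_minimal _ isClosed_closedBall
    intro y hy
    by_contra hn
    apply hy
    have hd : R < dist y z := by simpa using hn
    have : m y = 0 := by
      simp only [hm]
      apply max_eq_left
      rw [sqd_eq, sub_nonpos, le_div_iff₀ (by positivity)]
      nlinarith
    simp [this]
  · intro y; have := (hw0 y).le; positivity
  · intro y; have := (hw0 y).le; have := hm0 y; positivity
  · intro y i
    apply Dk_eq (hGc.differentiable (by norm_num) y)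
    have e0 : y + (0:ℝ) • EuclideanSpace.single i (1 : ℝ) = y := by simp
    have hs := sqd_line i z y
    have hA := (psq_hasDerivAt (1 - sqd z y / R ^ 2))
    have hB : HasDerivAt (fun s : ℝ => 1 - sqd z (y + s • EuclideanSpace.single i (1 : ℝ)) / R ^ 2)
        (-(2 * (y i - z i) / R ^ 2)) 0 := (hs.div_const (R ^ 2)).const_sub 1
    have hA' : HasDerivAt (fun s : ℝ => (max 0 s) ^ 2) (2 * m y)
        (1 - sqd z (y + (0:ℝ) • EuclideanSpace.single i (1 : ℝ)) / R ^ 2) := by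
      rw [e0]; exact hA
    have hC := hA'.comp (0:ℝ) hB
    have hD := ((hs.add_const (ρ ^ 2)).sqrt (by rw [e0]; have := hT0 y; positivity)).inv
      (by rw [e0]; exact (hS y).ne')
    have hE := hC.mul hD
    refine HasDerivAt.congr_deriv hE ?_
    simp only [Function.comp_apply, e0, Pi.inv_apply]
    have hsq : Real.sqrt (sqd z y + ρ ^ 2) = (w y)⁻¹ := by simp [hw]
    have hmm : max 0 (1 - sqd z y / R ^ 2) = m y := rfl
    rw [hsq, hmm]
    have hwn := (hw0 y).ne'
    field_simp
    ring
  · intro y hy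
    dsimp only
    rw [hident]
    have := hsecond y hy
    have h1 : 0 ≤ m y ^ 2 * w y ^ 3 * ρ ^ 2 := by have := (hw0 y).le; positivity
    linarith
  · intro y hy
    dsimp only
    rw [hident]
    have hd : dist y z < ρ := hy
    have hd0 : 0 ≤ dist y z := dist_nonneg
    have := hsecond y (mem_closedBall.2 (by linarith))
    have hT : sqd z y ≤ ρ ^ 2 := by rw [sqd_eq]; nlinarith
    have hm34 : 3 / 4 ≤ m y := by
      simp only [hm]
      apply le_max_of_le_right
      have : sqd z y / R ^ 2 ≤ 1 / 4 := by
        rw [div_le_iff₀ (by positivity)]; nlinarith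
      linarith
    have hwl : 7 / 10 ≤ w y * ρ := by
      have h1 := hw2 y
      have h2 : 1 ≤ 2 * (w y * ρ) ^ 2 := by nlinarith [sq_nonneg (w y)]
      have h3 : 0 ≤ w y * ρ := mul_nonneg (hw0 y).le hρ.le
      nlinarith
    have h4 : 3 / (16 * ρ) ≤ m y ^ 2 * w y ^ 3 * ρ ^ 2 := by
      rw [div_le_iff₀ (by positivity)]
      have e : m y ^ 2 * w y ^ 3 * ρ ^ 2 * (16 * ρ) = 16 * (m y ^ 2 * (w y * ρ) ^ 3) := by ring
      rw [e]
      have h5 : (3/4:ℝ) ^ 2 ≤ m y ^ 2 := by gcongr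
      have h6 : (7/10:ℝ) ^ 3 ≤ (w y * ρ) ^ 3 := by gcongr
      have h7 : (3/4:ℝ) ^ 2 * (7/10:ℝ) ^ 3 ≤ m y ^ 2 * (w y * ρ) ^ 3 := by gcongr
      norm_num at h7 ⊢
      linarith
    linarith

end

section

open Filter Topology

/-- squared gradient of a scalar function -/
def gsq (u : E3 → ℝ) (y : E3) : ℝ := ∑ k, Dk k u y ^ 2
/-- radial part of the gradient -/
def rad (z : E3) (u : E3 → ℝ) (y : E3) : ℝ := ∑ j, Dk j u y * (y j - z j)
/-- scalar Laplacian -/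
def lap (u : E3 → ℝ) (y : E3) : ℝ := ∑ k, Dk k (Dk k u) y

/-- Pohozaev vector field of a scalar function. -/
def pohoU (z : E3) (u : E3 → ℝ) (i : Fin 3) (y : E3) : ℝ :=
  1 / 2 * gsq u y * (y i - z i) - Dk i u y * rad z u y

theorem contDiffOn_gsq {Ω : Set E3} (hΩ : IsOpen Ω) {u : E3 → ℝ} {m n : WithTop ℕ∞}
    (hmn : m + 1 ≤ n) (hu : ContDiffOn ℝ n u Ω) : ContDiffOn ℝ m (gsq u) Ω :=
  ContDiffOn.sum fun k _ => (contDiffOn_Dk hΩ k hmn hu).pow 2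

theorem contDiffOn_rad {Ω : Set E3} (hΩ : IsOpen Ω) {u : E3 → ℝ} {m n : WithTop ℕ∞} (z : E3)
    (hmn : m + 1 ≤ n) (hu : ContDiffOn ℝ n u Ω) : ContDiffOn ℝ m (rad z u) Ω :=
  ContDiffOn.sum fun k _ => (contDiffOn_Dk hΩ k hmn hu).mul (by fun_prop)

theorem contDiffOn_pohoU {Ω : Set E3} (hΩ : IsOpen Ω) {u : E3 → ℝ} {m n : WithTop ℕ∞} (z : E3)
    (hmn : m + 1 ≤ n) (hu : ContDiffOn ℝ n u Ω) (i : Fin 3) : ContDiffOn ℝ m (pohoU z u i) Ω :=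
  ((contDiffOn_const.mul (contDiffOn_gsq hΩ hmn hu)).mul (by fun_prop)).sub
    ((contDiffOn_Dk hΩ i hmn hu).mul (contDiffOn_rad hΩ z hmn hu))

theorem div_pohoU {Ω : Set E3} (hΩ : IsOpen Ω) {u G H : E3 → ℝ} (z : E3)
    (hu : ContDiffOn ℝ 2 u Ω) (hG : ContDiff ℝ 1 G)
    (hGH : ∀ y i, Dk i G y = -H y * (y i - z i)) {y : E3} (hy : y ∈ Ω) :
    ∑ i, Dk i (fun y => G y * pohoU z u i y) y =
      G y * (1 / 2 * gsq u y) - G y * (lap u y * rad z u y)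
        - H y * (1 / 2 * sqd z y * gsq u y - rad z u y ^ 2) := by
  have hn := hΩ.mem_nhds hy
  have h11 : (1 : WithTop ℕ∞) + 1 ≤ 2 := by norm_num
  have hDd : ∀ k, DifferentiableAt ℝ (Dk k u) y := fun k =>
    ((contDiffOn_Dk hΩ k h11 hu).contDiffAt hn).differentiableAt (by norm_num)
  have hVd : ∀ i, DifferentiableAt ℝ (fun y => G y * pohoU z u i y) y := fun i =>
    (hG.contDiffAt.mul ((contDiffOn_pohoU hΩ z h11 hu i).contDiffAt hn)).differentiableAt
      (by norm_num)
  have e0 : ∀ i, y + (0:ℝ) • EuclideanSpace.single i (1 : ℝ) = y := fun i => by simp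
  have key : ∀ i, Dk i (fun y => G y * pohoU z u i y) y =
      (-H y * (y i - z i)) * pohoU z u i y + G y *
      ((1 / 2 * ∑ k, 2 * Dk k u y * Dk i (Dk k u) y) * (y i - z i) + 1 / 2 * gsq u y
       - (Dk i (Dk i u) y * rad z u y + Dk i u y *
          ∑ j, (Dk i (Dk j u) y * (y j - z j) + Dk j u y * (if j = i then 1 else 0)))) := by
    intro i
    apply Dk_eq (hVd i)
    have hGl := Dk_line (k := i) (hG.differentiable (by norm_num) y)
    rw [hGH] at hGl
    have hgl : HasDerivAt (fun s : ℝ => gsq u (y + s • EuclideanSpace.single i (1 : ℝ)))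
        (∑ k, 2 * Dk k u y * Dk i (Dk k u) y) 0 := by
      apply HasDerivAt.fun_sum
      intro k _
      have := (Dk_line (k := i) (hDd k)).fun_pow 2
      refine HasDerivAt.congr_deriv this ?_
      simp
    have hrl : HasDerivAt (fun s : ℝ => rad z u (y + s • EuclideanSpace.single i (1 : ℝ)))
        (∑ j, (Dk i (Dk j u) y * (y j - z j) + Dk j u y * (if j = i then 1 else 0))) 0 := by
      apply HasDerivAt.fun_sum
      intro j _
      have := (Dk_line (k := i) (hDd j)).fun_mul ((coord_line i j y).sub_const (z j))
      refine HasDerivAt.congr_deriv this ?_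
      simp only [e0]
    have hpl : HasDerivAt (fun s : ℝ => pohoU z u i (y + s • EuclideanSpace.single i (1 : ℝ)))
        ((1 / 2 * ∑ k, 2 * Dk k u y * Dk i (Dk k u) y) * (y i - z i) + 1 / 2 * gsq u y
       - (Dk i (Dk i u) y * rad z u y + Dk i u y *
          ∑ j, (Dk i (Dk j u) y * (y j - z j) + Dk j u y * (if j = i then 1 else 0)))) 0 := by
      have := (((hgl.const_mul (1/2)).fun_mul ((coord_line i i y).sub_const (z i)))).fun_sub
        ((Dk_line (k := i) (hDd i)).fun_mul hrl)
      refine HasDerivAt.congr_deriv this ?_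
      simp only [e0, if_true, mul_one]
    refine HasDerivAt.congr_deriv (hGl.fun_mul hpl) ?_
    simp only [e0]
  have hsym : ∀ i j, Dk i (Dk j u) y = Dk j (Dk i u) y := Dk_symm (hu.contDiffAt hn)
  rw [Finset.sum_congr rfl fun i _ => key i]
  have s1 := hsym 1 0
  have s2 := hsym 2 0
  have s3 := hsym 2 1
  simp only [pohoU, rad, gsq, lap, sqd, Fin.sum_univ_three, s1, s2, s3]
  simp
  ring

theorem div_pohoF {Ω : Set E3} (hΩ : IsOpen Ω) {F G H : E3 → ℝ} (z : E3)
    (hF : ContDiffOn ℝ 1 F Ω) (hG : ContDiff ℝ 1 G)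
    (hGH : ∀ y i, Dk i G y = -H y * (y i - z i)) {y : E3} (hy : y ∈ Ω) :
    ∑ i, Dk i (fun y => G y * (F y * (y i - z i))) y =
      3 * (G y * F y) + G y * rad z F y - H y * (sqd z y * F y) := by
  have hn := hΩ.mem_nhds hy
  have hFd : DifferentiableAt ℝ F y := (hF.contDiffAt hn).differentiableAt (by norm_num)
  have hGd : DifferentiableAt ℝ G y := hG.differentiable (by norm_num) y
  have e0 : ∀ i, y + (0:ℝ) • EuclideanSpace.single i (1 : ℝ) = y := fun i => by simp
  have key : ∀ i, Dk i (fun y => G y * (F y * (y i - z i))) y =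
      (-H y * (y i - z i)) * (F y * (y i - z i)) + G y * (Dk i F y * (y i - z i) + F y) := by
    intro i
    apply Dk_eq (hGd.mul (hFd.mul (by fun_prop)))
    have hGl := Dk_line (k := i) hGd
    rw [hGH] at hGl
    refine HasDerivAt.congr_deriv (hGl.fun_mul ((Dk_line (k := i) hFd).fun_mul
      ((coord_line i i y).sub_const (z i)))) ?_
    simp only [e0, if_true, mul_one, Pi.mul_apply]
  rw [Finset.sum_congr rfl fun i _ => key i]
  simp only [rad, sqd, Fin.sum_univ_three]
  ring

theorem rad_sq_le (z : E3) (u : E3 → ℝ) (y : E3) : rad z u y ^ 2 ≤ sqd z y * gsq u y := by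
  have := Finset.sum_mul_sq_le_sq_mul_sq Finset.univ (fun j => Dk j u y) (fun j => y j - z j)
  unfold rad sqd gsq
  linarith [mul_comm (∑ i, (y i - z i) ^ 2) (∑ k, Dk k u y ^ 2)]

/-- Energy monotonicity (up to constants) for solutions. -/
theorem monotone_energy {ι : Type} [Fintype ι] {Ω : Set E3} (hΩ : IsOpen Ω) (u : ι → E3 → ℝ)
    (F : E3 → ℝ) (hu : ∀ α, ContDiffOn ℝ 2 (u α) Ω) (hF : ContDiffOn ℝ 1 F Ω)
    (hF0 : ∀ y ∈ Ω, 0 ≤ F y)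
    (hEL : ∀ y ∈ Ω, ∀ k, Dk k F y = ∑ α, lap (u α) y * Dk k (u α) y)
    (z : E3) (R ρ : ℝ) (hρ : 0 < ρ) (hR : 2 * ρ ≤ R) (hball : closedBall z R ⊆ Ω) :
    3 / (16 * ρ) * ∫ y in ball z ρ, (1 / 2 * ∑ α, gsq (u α) y + F y)
      ≤ 4 / R * ∫ y in closedBall z R, (1 / 2 * ∑ α, gsq (u α) y + F y) := by
  obtain ⟨G, H, hG, hsupp, hG0, hH0, hGH, hlow, hlow2⟩ := exists_cutoff z R ρ hρ hR
  have hsΩ : tsupport G ⊆ Ω := hsupp.trans hball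
  have hcs : HasCompactSupport G :=
    (isCompact_closedBall z R).of_isClosed_subset (isClosed_tsupport G) hsupp
  have h11 : (1 : WithTop ℕ∞) + 1 ≤ 2 := by norm_num
  set e : E3 → ℝ := fun y => 1 / 2 * ∑ α, gsq (u α) y + F y with he
  set Tot : E3 → ℝ := fun y => ∑ α, ∑ i, Dk i (fun y => G y * pohoU z (u α) i y) y
    + ∑ i, Dk i (fun y => G y * (F y * (y i - z i))) y with hTot
  have hI1 := fun α i => integral_Dk_cutoff hΩ i hG hsΩ hcs (contDiffOn_pohoU hΩ z h11 (hu α) i)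
  have hI2 := fun i => integral_Dk_cutoff hΩ i hG hsΩ hcs
    (hF.mul (show ContDiffOn ℝ 1 (fun y : E3 => y i - z i) Ω by fun_prop))
  have hTint : Integrable Tot :=
    (integrable_finsetSum _ fun α _ => integrable_finsetSum _ fun i _ => (hI1 α i).1).add
      (integrable_finsetSum _ fun i _ => (hI2 i).1)
  have hT0 : ∫ y, Tot y = 0 := by
    simp only [hTot]
    rw [integral_add (integrable_finsetSum _ fun α _ => integrable_finsetSum _
      fun i _ => (hI1 α i).1) (integrable_finsetSum _ fun i _ => (hI2 i).1),
      integral_finsetSum _ fun α _ => integrable_finsetSum _ fun i _ => (hI1 α i).1,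
      integral_finsetSum _ fun i _ => (hI2 i).1]
    rw [Finset.sum_eq_zero fun i _ => (hI2 i).2, Finset.sum_eq_zero, add_zero]
    intro α _
    rw [integral_finsetSum _ fun i _ => (hI1 α i).1]
    exact Finset.sum_eq_zero fun i _ => (hI1 α i).2
  have hTB : ∫ y in closedBall z R, Tot y = 0 := by
    rw [setIntegral_eq_integral_of_forall_compl_eq_zero, hT0]
    intro y hy
    have hy' : y ∉ tsupport G := fun h => hy (hsupp h)
    simp only [hTot]
    simp [Dk_cutoff_zero _ hy']
  have hec : ContinuousOn e Ω := by
    refine (continuousOn_const.mul (continuousOn_finsetSum _ fun α _ => ?_)).add hF.continuousOn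
    exact (contDiffOn_gsq hΩ h11 (hu α)).continuousOn
  have heI : IntegrableOn e (closedBall z R) :=
    (hec.mono hball).integrableOn_compact (isCompact_closedBall z R)
  have hsub : ball z ρ ⊆ closedBall z R :=
    (ball_subset_ball (by linarith)).trans ball_subset_closedBall
  have he0 : ∀ y ∈ Ω, 0 ≤ e y := fun y hy => by
    have : 0 ≤ ∑ α, gsq (u α) y := Finset.sum_nonneg fun α _ => by unfold gsq; positivity
    have := hF0 y hy
    simp only [he]; linarith
  have hpt : ∀ y ∈ closedBall z R,
      (ball z ρ).indicator (fun y => 3 / (16 * ρ) * e y) y - 4 / R * e y ≤ Tot y := by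
    intro y hy
    have hyΩ := hball hy
    have hT : Tot y = G y * (1 / 2 * ∑ α, gsq (u α) y + 3 * F y)
        - H y * (sqd z y * e y - ∑ α, rad z (u α) y ^ 2) := by
      simp only [hTot]
      rw [div_pohoF hΩ z hF hG hGH hyΩ,
        Finset.sum_congr rfl fun α _ => div_pohoU hΩ z (hu α) hG hGH hyΩ]
      have hr : rad z F y = ∑ α, lap (u α) y * rad z (u α) y := by
        simp only [rad]
        rw [Finset.sum_congr rfl fun j _ => by rw [hEL y hyΩ j, Finset.sum_mul]]
        rw [Finset.sum_comm]
        refine Finset.sum_congr rfl fun α _ => ?_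
        rw [Finset.mul_sum]
        exact Finset.sum_congr rfl fun j _ => by ring
      rw [hr, Finset.sum_sub_distrib, Finset.sum_sub_distrib, ← Finset.mul_sum, ← Finset.mul_sum,
        ← Finset.mul_sum, ← Finset.mul_sum, Finset.sum_sub_distrib, ← Finset.mul_sum]
      simp only [he]
      ring
    have hge : (G y - H y * sqd z y) * e y ≤ Tot y := by
      rw [hT]
      have h1 : 0 ≤ H y * ∑ α, rad z (u α) y ^ 2 :=
        mul_nonneg (hH0 y) (Finset.sum_nonneg fun α _ => sq_nonneg _)
      have h2 : 0 ≤ G y * F y := mul_nonneg (hG0 y) (hF0 y hyΩ)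
      simp only [he] at *
      nlinarith
    refine le_trans ?_ hge
    by_cases hb : y ∈ ball z ρ
    · rw [indicator_of_mem hb]
      have := mul_le_mul_of_nonneg_right (hlow2 y hb) (he0 y hyΩ)
      linarith
    · rw [indicator_of_notMem hb]
      have := mul_le_mul_of_nonneg_right (hlow y hy) (he0 y hyΩ)
      linarith
  have hindI : IntegrableOn ((ball z ρ).indicator (fun y => 3 / (16 * ρ) * e y)) (closedBall z R) :=
    (heI.const_mul _).indicator measurableSet_ball
  have hmono := setIntegral_mono_on (hindI.sub (heI.const_mul (4 / R))) hTint.integrableOn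
    measurableSet_closedBall hpt
  rw [hTB] at hmono
  have hsplit : ∫ y in closedBall z R, ((ball z ρ).indicator (fun y => 3 / (16 * ρ) * e y)
      - fun y => 4 / R * e y) y = 3 / (16 * ρ) * (∫ y in ball z ρ, e y)
        - 4 / R * ∫ y in closedBall z R, e y := by
    simp only [Pi.sub_apply]
    rw [integral_sub hindI (heI.const_mul (4 / R)), integral_const_mul,
      setIntegral_indicator measurableSet_ball, inter_eq_right.2 hsub, integral_const_mul]
  rw [hsplit] at hmono
  linarith

end

section

open Filter Topology

theorem second_deriv_nonpos {f f' : ℝ → ℝ} {f'' : ℝ}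
    (h1 : ∀ᶠ s in 𝓝 (0:ℝ), HasDerivAt f (f' s) s) (h2 : HasDerivAt f' f'' 0)
    (hmax : IsLocalMax f 0) : f'' ≤ 0 := by
  by_contra hpos
  push Not at hpos
  have hd : deriv f =ᶠ[𝓝 0] f' := h1.mono fun s hs => hs.deriv
  have hdd : deriv (deriv f) 0 = f'' := by rw [hd.deriv_eq, h2.deriv]
  have hmin : IsLocalMin f 0 := isLocalMin_of_deriv_deriv_pos (by rw [hdd]; exact hpos)
    hmax.deriv_eq_zero h1.self_of_nhds.continuousAt
  have hconst : f =ᶠ[𝓝 0] fun _ => f 0 := by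
    filter_upwards [hmax, hmin] with s a b using le_antisymm a b
  have h3 : deriv f =ᶠ[𝓝 0] fun _ => 0 := by
    have := hconst.deriv
    simpa using this
  have : deriv (deriv f) 0 = 0 := by rw [h3.deriv_eq]; simp
  rw [hdd] at this
  linarith

theorem line_second {Ω : Set E3} (hΩ : IsOpen Ω) {u : E3 → ℝ} (hu : ContDiffOn ℝ 2 u Ω)
    {y : E3} (hy : y ∈ Ω) (j : Fin 3) (c : ℝ) :
    (∀ᶠ s in 𝓝 (0:ℝ), HasDerivAt (fun s : ℝ => u (y + (c * s) • EuclideanSpace.single j (1:ℝ)))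
      (c * Dk j u (y + (c * s) • EuclideanSpace.single j (1:ℝ))) s) ∧
    HasDerivAt (fun s : ℝ => c * Dk j u (y + (c * s) • EuclideanSpace.single j (1:ℝ)))
      (c ^ 2 * Dk j (Dk j u) y) 0 := by
  have hlin : ∀ s : ℝ, HasDerivAt (fun s : ℝ => c * s) c s := fun s => by
    simpa using (hasDerivAt_id s).const_mul c
  constructor
  · have hcont : Continuous (fun s : ℝ => y + (c * s) • EuclideanSpace.single j (1:ℝ)) := by
      fun_prop
    have hpre : ∀ᶠ s in 𝓝 (0:ℝ), y + (c * s) • EuclideanSpace.single j (1:ℝ) ∈ Ω := by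
      apply hcont.continuousAt.eventually_mem
      simpa using hΩ.mem_nhds hy
    filter_upwards [hpre] with s hs
    have hd : DifferentiableAt ℝ u (y + (c * s) • EuclideanSpace.single j (1:ℝ)) :=
      (hu.contDiffAt (hΩ.mem_nhds hs)).differentiableAt (by norm_num)
    have := (Dk_line_at hd).comp s (hlin s)
    refine HasDerivAt.congr_deriv this (mul_comm _ _)
  · have hd : DifferentiableAt ℝ (Dk j u) (y + (c * 0) • EuclideanSpace.single j (1:ℝ)) := by
      have h := ((contDiffOn_Dk hΩ j (m := 1) (by norm_num) hu).contDiffAt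
        (hΩ.mem_nhds hy)).differentiableAt (by norm_num)
      simpa using h
    have := ((Dk_line_at hd).comp (0:ℝ) (hlin 0)).const_mul c
    refine HasDerivAt.congr_deriv this ?_
    simp
    ring

theorem reflect_estimate {Ω : Set E3} (hΩ : IsOpen Ω) {u : E3 → ℝ} (hu : ContDiffOn ℝ 2 u Ω)
    {p : E3} {d M N : ℝ} (hd : 0 < d) (hM : 0 ≤ M) (hball : closedBall p d ⊆ Ω)
    (hub : ∀ y ∈ closedBall p d, |u y| ≤ M) (hlap : ∀ y ∈ closedBall p d, |lap u y| < N)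
    (k : Fin 3) (t : ℝ) (ht0 : 0 ≤ t) (htd : t ≤ d) :
    u (p + t • EuclideanSpace.single k (1:ℝ)) - u (p + (-t) • EuclideanSpace.single k (1:ℝ))
      ≤ 2 * t * (3 * M / d + N * d / 2) := by
  have hN : 0 < N := (abs_nonneg _).trans_lt (hlap p (mem_closedBall_self hd.le))
  set E : Fin 3 → E3 := fun j => EuclideanSpace.single j (1:ℝ) with hE
  have hEc : ∀ i j : Fin 3, (E j) i = if i = j then 1 else 0 := by
    intro i j; simp [hE]
  set σ : E3 → E3 := fun y => y - (2 * (y k - p k)) • E k with hσ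
  have hσc : ∀ y i, σ y i = y i - (if i = k then 2 * (y k - p k) else 0) := by
    intro y i; simp [hσ, hEc]
  have hσd : ∀ y, sqd p (σ y) = sqd p y := by
    intro y
    unfold sqd
    refine Finset.sum_congr rfl fun i _ => ?_
    rw [hσc]
    split_ifs with h
    · subst h; ring
    · ring
  have hball_iff : ∀ y, y ∈ closedBall p d ↔ sqd p y ≤ d ^ 2 := by
    intro y
    rw [mem_closedBall, sqd_eq, sq_le_sq₀ dist_nonneg hd.le]
  have hσb : ∀ y ∈ closedBall p d, σ y ∈ closedBall p d := by
    intro y hy; rw [hball_iff] at *; rw [hσd]; exact hy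
  set ψ : E3 → ℝ := fun y => M / d ^ 2 * (sqd p y - 3 * (y k - p k) ^ 2 + 3 * d * (y k - p k))
    + N / 2 * ((y k - p k) * (d - (y k - p k))) with hψ
  set w : E3 → ℝ := fun y => 1 / 2 * (u y - u (σ y)) - ψ y with hw
  set D : Set E3 := closedBall p d ∩ {y | 0 ≤ y k - p k} with hD
  have hDc : IsCompact D := by
    apply (isCompact_closedBall p d).inter_right
    exact isClosed_le continuous_const (by fun_prop)
  have hs_le : ∀ y ∈ closedBall p d, (y k - p k) ^ 2 ≤ sqd p y := by
    intro y _
    exact Finset.single_le_sum (f := fun i => (y i - p i) ^ 2) (fun i _ => sq_nonneg _)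
      (Finset.mem_univ k)
  have hwc : ContinuousOn w D := by
    have huc := hu.continuousOn.mono hball
    have hσcont : Continuous σ := by simp only [hσ]; fun_prop
    have hψc : Continuous ψ := by
      have := (contDiff_sqd p (n := 0)).continuous
      simp only [hψ]; fun_prop
    refine ContinuousOn.sub (continuousOn_const.mul (ContinuousOn.sub
      (huc.mono inter_subset_left) ?_)) hψc.continuousOn
    exact huc.comp hσcont.continuousOn fun y hy => hσb y hy.1
  have hpD : p ∈ D := ⟨mem_closedBall_self hd.le, by simp⟩
  obtain ⟨y, hyD, hymax⟩ := hDc.exists_isMaxOn ⟨p, hpD⟩ hwc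
  have hyb := hyD.1
  have hys : 0 ≤ y k - p k := hyD.2
  have hMd : 0 ≤ M / d ^ 2 := by positivity
  have hysq := hs_le y hyb
  have hyd := (hball_iff y).1 hyb
  have hyd' : y k - p k ≤ d := by nlinarith
  have hwy : w y ≤ 0 := by
    by_contra hpos
    push Not at hpos
    -- not on the flat part
    have hs_pos : 0 < y k - p k := by
      rcases hys.lt_or_eq with h | h
      · exact h
      · exfalso
        have h1 : σ y = y := by simp only [hσ]; rw [← h]; simp
        have h2 : w y = - (M / d ^ 2 * sqd p y) := by
          simp only [hw, hψ]; rw [h1, ← h]; ring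
        have : 0 ≤ M / d ^ 2 * sqd p y := mul_nonneg hMd ((sq_nonneg _).trans hysq)
        linarith
    have hd_lt : sqd p y < d ^ 2 := by
      rcases hyd.lt_or_eq with h | h
      · exact h
      · exfalso
        have h1 : w y ≤ M - ψ y := by
          have a1 := abs_le.1 (hub y hyb)
          have a2 := abs_le.1 (hub _ (hσb y hyb))
          simp only [hw]; linarith
        have h2 : M ≤ ψ y := by
          simp only [hψ]
          rw [h]
          have e1 : d ^ 2 ≤ d ^ 2 - 3 * (y k - p k) ^ 2 + 3 * d * (y k - p k) := by nlinarith
          have e2 := mul_le_mul_of_nonneg_left e1 hMd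
          have e3 : M / d ^ 2 * d ^ 2 = M := by field_simp
          have e4 : 0 ≤ N / 2 * ((y k - p k) * (d - (y k - p k))) :=
            mul_nonneg (by linarith) (mul_nonneg hys (by linarith))
          linarith
        linarith
    -- interior maximum
    have hnhds : D ∈ 𝓝 y := by
      have o1 : IsOpen {y : E3 | sqd p y < d ^ 2} :=
        isOpen_lt (contDiff_sqd p (n := 0)).continuous continuous_const
      have o2 : IsOpen {y : E3 | 0 < y k - p k} := isOpen_lt continuous_const (by fun_prop)
      filter_upwards [o1.mem_nhds hd_lt, o2.mem_nhds hs_pos] with x h1 h2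
      exact ⟨(hball_iff x).2 (le_of_lt h1), le_of_lt h2⟩
    have hlocmax : IsLocalMax w y := hymax.isLocalMax hnhds
    set sg : Fin 3 → ℝ := fun j => if j = k then -1 else 1 with hsg
    set cc : Fin 3 → ℝ := fun j => M / d ^ 2 * (2 - (if j = k then 6 else 0))
      - (if j = k then N else 0) with hcc
    have hsecond : ∀ j, 1 / 2 * (Dk j (Dk j u) y - Dk j (Dk j u) (σ y)) - cc j ≤ 0 := by
      intro j
      set c1 : ℝ := M / d ^ 2 * (2 * (y j - p j) - (if j = k then 6 * (y k - p k) - 3 * d else 0))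
        + (if j = k then N / 2 * (d - 2 * (y k - p k)) else 0) with hc1
      have hform : ∀ s : ℝ, w (y + (1 * s) • E j) = 1 / 2 * (u (y + (1 * s) • E j)
          - u (σ y + (sg j * s) • E j)) - (ψ y + c1 * s + cc j / 2 * s ^ 2) := by
        intro s
        have h1 : σ (y + (1 * s) • E j) = σ y + (sg j * s) • E j := by
          ext i
          simp only [hσc, PiLp.add_apply, PiLp.smul_apply, hEc, smul_eq_mul, hsg]
          by_cases hjk : j = k
          · subst hjk
            by_cases hij : i = j
            · simp [hij]; ring
            · simp [hij]
          · by_cases hij : i = j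
            · subst hij; simp [hjk]
            · have : ¬ k = j := fun h => hjk h.symm
              simp [hjk, hij, this]
        have h2 : sqd p (y + (1 * s) • E j) = sqd p y + 2 * s * (y j - p j) + s ^ 2 := by
          simp only [sqd, PiLp.add_apply, PiLp.smul_apply, hEc, smul_eq_mul, Fin.sum_univ_three]
          fin_cases j <;> simp <;> ring
        have h3 : (y + (1 * s) • E j) k = y k + (if j = k then s else 0) := by
          simp only [PiLp.add_apply, PiLp.smul_apply, hEc, smul_eq_mul]
          by_cases hjk : j = k
          · simp [hjk]
          · have : ¬ k = j := fun h => hjk h.symm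
            simp [hjk, this]
        simp only [hw]
        rw [h1]
        simp only [hψ, hc1, hcc]
        rw [h2, h3]
        by_cases hjk : j = k
        · subst hjk; simp; ring
        · simp [hjk]; ring
      obtain ⟨a1, a2⟩ := line_second hΩ hu (hball hyb) j 1
      obtain ⟨b1, b2⟩ := line_second hΩ hu (hball (hσb y hyb)) j (sg j)
      have hq : ∀ s : ℝ, HasDerivAt (fun s : ℝ => ψ y + c1 * s + cc j / 2 * s ^ 2)
          (c1 + cc j * s) s := by
        intro s
        have := (((hasDerivAt_id s).const_mul c1).const_add (ψ y)).fun_add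
          ((hasDerivAt_pow 2 s).const_mul (cc j / 2))
        refine HasDerivAt.congr_deriv this ?_
        simp
        ring
      have hq2 : HasDerivAt (fun s : ℝ => c1 + cc j * s) (cc j) 0 := by
        simpa using ((hasDerivAt_id (0:ℝ)).const_mul (cc j)).const_add c1
      have hsg2 : sg j ^ 2 = 1 := by simp only [hsg]; split_ifs <;> norm_num
      have hres := second_deriv_nonpos (f := fun s : ℝ => w (y + (1 * s) • E j))
        (f' := fun s => 1 / 2 * (1 * Dk j u (y + (1 * s) • E j)
          - sg j * Dk j u (σ y + (sg j * s) • E j)) - (c1 + cc j * s))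
        (f'' := 1 / 2 * (1 ^ 2 * Dk j (Dk j u) y - sg j ^ 2 * Dk j (Dk j u) (σ y)) - cc j)
        (by
          filter_upwards [a1, b1] with s ha hb
          have := ((ha.fun_sub hb).const_mul (1 / 2)).fun_sub (hq s)
          rw [show (fun s : ℝ => w (y + (1 * s) • E j)) = _ from funext hform]
          exact this)
        (((a2.fun_sub b2).const_mul (1 / 2)).fun_sub hq2)
        (by
          have hc : ContinuousAt (fun s : ℝ => y + (1 * s) • E j) 0 := by fun_prop
          have : IsLocalMax w ((fun s : ℝ => y + (1 * s) • E j) 0) := by simpa using hlocmax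
          exact IsLocalMax.comp_continuous (g := fun s : ℝ => y + (1 * s) • E j) this hc)
      rw [hsg2] at hres
      simpa using hres
    have hsum := Finset.sum_nonpos fun j (_ : j ∈ Finset.univ) => hsecond j
    have hccs : ∑ j, cc j = -N := by
      simp only [hcc, Fin.sum_univ_three]
      fin_cases k <;> simp <;> ring
    have hl : ∑ j, (1 / 2 * (Dk j (Dk j u) y - Dk j (Dk j u) (σ y)) - cc j)
        = 1 / 2 * (lap u y - lap u (σ y)) + N := by
      rw [Finset.sum_sub_distrib, hccs, ← Finset.mul_sum, Finset.sum_sub_distrib]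
      simp only [lap]; ring
    have l1 := abs_lt.1 (hlap y hyb)
    have l2 := abs_lt.1 (hlap _ (hσb y hyb))
    linarith [l1.1, l2.2]
  -- conclude
  have hqD : p + t • E k ∈ D := by
    constructor
    · rw [mem_closedBall, dist_eq_norm]
      simp [hE, norm_smul, abs_of_nonneg ht0, htd]
    · simp [hEc, ht0]
  have hfin : w (p + t • E k) ≤ 0 := (hymax hqD).trans hwy
  have h1 : σ (p + t • E k) = p + (-t) • E k := by
    ext i
    simp only [hσc, PiLp.add_apply, PiLp.smul_apply, hEc, smul_eq_mul]
    by_cases hik : i = k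
    · simp [hik]; ring
    · simp [hik]
  have h2 : (p + t • E k) k - p k = t := by simp [hEc]
  have h3 : sqd p (p + t • E k) = t ^ 2 := by
    rw [sqd_eq, dist_eq_norm]
    simp [hE, norm_smul]
  have h4 : ψ (p + t • E k) ≤ t * (3 * M / d + N * d / 2) := by
    simp only [hψ]
    rw [h2, h3]
    have : M / d ^ 2 * (t ^ 2 - 3 * t ^ 2 + 3 * d * t) = t * (3 * M / d) - M / d ^ 2 * (2 * t ^ 2) := by
      field_simp; ring
    rw [this]
    have : 0 ≤ M / d ^ 2 * (2 * t ^ 2) := by positivity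
    nlinarith [mul_nonneg hN.le (sq_nonneg t)]
  simp only [hw] at hfin
  rw [h1] at hfin
  linarith

theorem lip_estimate {Ω : Set E3} (hΩ : IsOpen Ω) {u : E3 → ℝ} (hu : ContDiffOn ℝ 2 u Ω)
    {z : E3} {d M N : ℝ} (hd : 0 < d) (hM : 0 ≤ M) (hball : closedBall z (4 * d) ⊆ Ω)
    (hub : ∀ y ∈ closedBall z (4 * d), |u y| ≤ M)
    (hlap : ∀ y ∈ closedBall z (4 * d), |lap u y| < N) (y : E3) (hy : dist y z ≤ d) :
    |u y - u z| ≤ 3 * (3 * M / d + N * d / 2) * dist y z := by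
  set K := 3 * M / d + N * d / 2 with hK
  have hN : 0 < N := (abs_nonneg _).trans_lt (hlap z (mem_closedBall_self (by linarith)))
  have hK0 : 0 ≤ K := by positivity
  have hcoord : ∀ i, |y i - z i| ≤ dist y z := by
    intro i
    have h1 : (y i - z i) ^ 2 ≤ sqd z y :=
      Finset.single_le_sum (f := fun i => (y i - z i) ^ 2) (fun i _ => sq_nonneg _)
        (Finset.mem_univ i)
    rw [sqd_eq] at h1
    exact abs_le_of_sq_le_sq h1 dist_nonneg
  -- one step
  have hstep : ∀ (x : E3) (k : Fin 3) (τ : ℝ), dist x z ≤ 2 * d → |τ| ≤ d →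
      |u (x + τ • EuclideanSpace.single k (1:ℝ)) - u x| ≤ |τ| * K := by
    intro x k τ hx hτ
    set p : E3 := x + (τ / 2) • EuclideanSpace.single k (1:ℝ) with hp
    have hpx : dist p x ≤ d / 2 := by
      rw [dist_eq_norm]; simp [hp, norm_smul, abs_div]; linarith
    have hsub : closedBall p d ⊆ closedBall z (4 * d) := by
      apply closedBall_subset_closedBall'
      have := dist_triangle p x z
      linarith
    have hest := fun t => reflect_estimate hΩ hu hd hM (hsub.trans hball)
      (fun y hy => hub y (hsub hy)) (fun y hy => hlap y (hsub hy)) k t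
    have e1 : p + (τ / 2) • EuclideanSpace.single k (1:ℝ)
        = x + τ • EuclideanSpace.single k (1:ℝ) := by
      rw [hp, add_assoc, ← add_smul]; congr 2; ring
    have e2 : p + (-(τ / 2)) • EuclideanSpace.single k (1:ℝ) = x := by
      rw [hp, add_assoc, ← add_smul]; simp
    have hun : ContDiffOn ℝ 2 (fun y => -u y) Ω := hu.neg
    have hneg_lap : ∀ x, x ∈ closedBall p d → |lap (fun y => -u y) x| < N := by
      intro x hx
      have : lap (fun y => -u y) x = - lap u x := by
        have hD : ∀ k, Dk k (fun y => -u y) = fun y => - Dk k u y := by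
          intro k; funext y; simp [Dk, fderiv_fun_neg]
        simp only [lap, hD]
        rw [← Finset.sum_neg_distrib]
        refine Finset.sum_congr rfl fun k _ => ?_
        exact congrFun (show Dk k (fun y => - Dk k u y) = fun y => -Dk k (Dk k u) y by
          funext y; simp only [Dk]; rw [fderiv_fun_neg]; rfl) x
      rw [this, abs_neg]; exact hlap x (hsub hx)
    have hest' := fun t => reflect_estimate hΩ hun hd hM (hsub.trans hball)
      (fun y hy => by rw [abs_neg]; exact hub y (hsub hy)) hneg_lap k t
    rcases le_total 0 τ with h | h
    · rw [abs_of_nonneg h] at hτ ⊢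
      have a1 := hest (τ / 2) (by linarith) (by linarith)
      have a2 := hest' (τ / 2) (by linarith) (by linarith)
      rw [e1, e2, ← hK] at a1 a2
      rw [abs_le]; constructor <;> linarith
    · rw [abs_of_nonpos h] at hτ ⊢
      have a1 := hest (-(τ / 2)) (by linarith) (by linarith)
      have a2 := hest' (-(τ / 2)) (by linarith) (by linarith)
      rw [neg_neg, e1, e2, ← hK] at a1 a2
      rw [abs_le]; constructor <;> linarith
  set x1 : E3 := z + (y 0 - z 0) • EuclideanSpace.single 0 (1:ℝ) with hx1
  set x2 : E3 := x1 + (y 1 - z 1) • EuclideanSpace.single 1 (1:ℝ) with hx2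
  have hx3 : x2 + (y 2 - z 2) • EuclideanSpace.single 2 (1:ℝ) = y := by
    ext i
    fin_cases i <;> simp [hx2, hx1]
  have d1 : dist x1 z ≤ d := by
    rw [dist_eq_norm]; simp [hx1, norm_smul]; exact (hcoord 0).trans hy
  have d2 : dist x2 x1 ≤ d := by
    rw [dist_eq_norm]; simp [hx2, norm_smul]; exact (hcoord 1).trans hy
  have d3 := dist_triangle x2 x1 z
  have b1 := hstep z 0 (y 0 - z 0) (by simp; linarith) ((hcoord 0).trans hy)
  have b2 := hstep x1 1 (y 1 - z 1) (by linarith) ((hcoord 1).trans hy)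
  have b3 := hstep x2 2 (y 2 - z 2) (by linarith) ((hcoord 2).trans hy)
  rw [← hx1] at b1
  rw [← hx2] at b2
  rw [hx3] at b3
  have c1 := mul_le_mul_of_nonneg_right (hcoord 0) hK0
  have c2 := mul_le_mul_of_nonneg_right (hcoord 1) hK0
  have c3 := mul_le_mul_of_nonneg_right (hcoord 2) hK0
  have : u y - u z = (u y - u x2) + (u x2 - u x1) + (u x1 - u z) := by ring
  rw [this]
  refine (abs_add_three _ _ _).trans ?_
  linarith

end

section

open Filter Topology

theorem diag_symm {Q : M3} (h : Q.IsSymm) : ∃ (U : M3) (l : Fin 3 → ℝ),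
    Q = U * diagonal l * Uᵀ ∧ U * Uᵀ = 1 ∧ Uᵀ * U = 1 := by
  have hH : Q.IsHermitian := by
    rw [Matrix.IsHermitian, Matrix.conjTranspose_eq_transpose_of_trivial]; exact h
  refine ⟨hH.eigenvectorUnitary, hH.eigenvalues, ?_, ?_, ?_⟩
  · have := hH.spectral_theorem
    rw [Unitary.conjStarAlgAut_apply, star_eq_conjTranspose,
      conjTranspose_eq_transpose_of_trivial] at this
    exact this
  · have := Unitary.coe_mul_star_self hH.eigenvectorUnitary
    rwa [Unitary.coe_star, star_eq_conjTranspose, conjTranspose_eq_transpose_of_trivial] at this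
  · have := Unitary.coe_star_mul_self hH.eigenvectorUnitary
    rwa [star_eq_conjTranspose, conjTranspose_eq_transpose_of_trivial] at this

theorem sstar_pos {a b c : ℝ} (hb : 0 < b) (hc : 0 < c) : 0 < sstar a b c := by
  unfold sstar
  have := Real.sqrt_nonneg (b ^ 2 + 24 * a * c)
  positivity

theorem sstar_eq {a b c : ℝ} (ha : 0 ≤ a) (hc : 0 < c) :
    3 * a = 2 * c * sstar a b c ^ 2 - b * sstar a b c := by
  have h := Real.sq_sqrt (show 0 ≤ b ^ 2 + 24 * a * c by positivity)
  unfold sstar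
  set t := Real.sqrt (b ^ 2 + 24 * a * c) with ht
  clear_value t
  have h1 : a = (t ^ 2 - b ^ 2) / (24 * c) := by
    field_simp; linarith
  rw [h1]
  field_simp
  ring

set_option maxHeartbeats 1000000 in
/-- eigenvalue form of the bulk potential inequality -/
theorem bulk_eig {a b c s : ℝ} (ha : 0 ≤ a) (hb : 0 < b) (hc : 0 < c) (hs : 0 < s)
    (hse : 3 * a = 2 * c * s ^ 2 - b * s) (x y z : ℝ) (h0 : x + y + z = 0) :
    let f := s ^ 2 / 27 * (9 * a + 2 * b * s - 3 * c * s ^ 2)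
      - a / 2 * (x ^ 2 + y ^ 2 + z ^ 2) - b / 3 * (x ^ 3 + y ^ 3 + z ^ 3)
      + c / 4 * (x ^ 2 + y ^ 2 + z ^ 2) ^ 2
    0 ≤ f ∧ (f = 0 → (x = 2 * s / 3 ∧ y = -s / 3 ∧ z = -s / 3) ∨
      (x = -s / 3 ∧ y = 2 * s / 3 ∧ z = -s / 3) ∨ (x = -s / 3 ∧ y = -s / 3 ∧ z = 2 * s / 3)) := by
  intro f
  set σ := Real.sqrt (3 / 2 * (x ^ 2 + y ^ 2 + z ^ 2)) with hσ
  have hσ0 : 0 ≤ σ := Real.sqrt_nonneg _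
  have hσ2 : σ ^ 2 = 3 / 2 * (x ^ 2 + y ^ 2 + z ^ 2) := Real.sq_sqrt (by positivity)
  have hp2 : x ^ 2 + y ^ 2 + z ^ 2 = 2 / 3 * σ ^ 2 := by linarith
  set p3 := x ^ 3 + y ^ 3 + z ^ 3 with hp3
  have hz : z = -x - y := by linarith
  have hdisc : (2 / 9 * σ ^ 3) ^ 2 - p3 ^ 2 = 1 / 3 * ((x - y) * (y - z) * (z - x)) ^ 2 := by
    have : (2 / 9 * σ ^ 3) ^ 2 = 4 / 81 * (σ ^ 2) ^ 3 := by ring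
    rw [this, hσ2, hp3, hz]; ring
  have hle : p3 ≤ 2 / 9 * σ ^ 3 := by
    have h1 : p3 ^ 2 ≤ (2 / 9 * σ ^ 3) ^ 2 := by
      have := sq_nonneg ((x - y) * (y - z) * (z - x))
      linarith
    exact (abs_le_of_sq_le_sq' h1 (by positivity)).2
  have ha' : a = (2 * c * s ^ 2 - b * s) / 3 := by linarith
  have hf : f = 1 / 27 * ((s - σ) ^ 2 * (3 * c * (s + σ) ^ 2 - b * (s + 2 * σ)))
      + b / 3 * (2 / 9 * σ ^ 3 - p3) := by
    simp only [f]
    rw [hp2, ha']; ring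
  have hbs : b ≤ 2 * c * s := by
    have h1 : s * (2 * c * s - b) = 3 * a := by rw [hse]; ring
    have h2 : 0 ≤ s * (2 * c * s - b) := by rw [h1]; linarith
    have := nonneg_of_mul_nonneg_right h2 hs
    linarith
  have hpos : 0 < 3 * c * (s + σ) ^ 2 - b * (s + 2 * σ) := by
    have h1 : b * (s + 2 * σ) ≤ 2 * c * s * (s + 2 * σ) :=
      mul_le_mul_of_nonneg_right hbs (by linarith)
    have h2 : 0 < c * s ^ 2 := by positivity
    have h3 : 0 ≤ c * s * σ := by positivity
    have h4 : 0 ≤ c * σ ^ 2 := by positivity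
    have h5 : 3 * c * (s + σ) ^ 2 - 2 * c * s * (s + 2 * σ)
        = c * s ^ 2 + 2 * (c * s * σ) + 3 * (c * σ ^ 2) := by ring
    linarith
  have t1 : 0 ≤ (s - σ) ^ 2 * (3 * c * (s + σ) ^ 2 - b * (s + 2 * σ)) :=
    mul_nonneg (sq_nonneg _) hpos.le
  have t2 : 0 ≤ b / 3 * (2 / 9 * σ ^ 3 - p3) := mul_nonneg (by linarith) (by linarith)
  refine ⟨by rw [hf]; linarith, fun h => ?_⟩
  rw [hf] at h
  have e1 : (s - σ) ^ 2 * (3 * c * (s + σ) ^ 2 - b * (s + 2 * σ)) = 0 := by linarith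
  have e2 : b / 3 * (2 / 9 * σ ^ 3 - p3) = 0 := by linarith
  have e3 : σ = s := by
    rcases mul_eq_zero.1 e1 with h | h
    · have := pow_eq_zero_iff (two_ne_zero) |>.1 h
      linarith
    · linarith
  have e4 : p3 = 2 / 9 * s ^ 3 := by
    rcases mul_eq_zero.1 e2 with h | h
    · linarith
    · rw [e3] at h; linarith
  rw [e3] at hp2 hdisc
  rw [e4] at hdisc
  have e5 : (x - y) * (y - z) * (z - x) = 0 := by
    have : ((x - y) * (y - z) * (z - x)) ^ 2 = 0 := by linarith
    exact pow_eq_zero_iff (two_ne_zero) |>.1 this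
  have core : ∀ v w : ℝ, v + v + w = 0 → v ^ 2 + v ^ 2 + w ^ 2 = 2 / 3 * s ^ 2 →
      v ^ 3 + v ^ 3 + w ^ 3 = 2 / 9 * s ^ 3 → v = -s / 3 ∧ w = 2 * s / 3 := by
    intro v w g1 g2 g3
    have hw : w = -2 * v := by linarith
    subst hw
    have g4 : v ^ 2 = s ^ 2 / 9 := by linarith
    have g5 : v * v ^ 2 = - (s ^ 3 / 27) := by
      have g7 : v ^ 3 + v ^ 3 + (-2 * v) ^ 3 = -6 * (v * v ^ 2) := by ring
      rw [g7] at g3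
      clear e1 e2 hdisc hf h t1 t2 hle hpos
      linarith
    rw [g4] at g5
    have g6 : v = -s / 3 := by
      have : s ^ 2 * (v + s / 3) = 0 := by linarith
      rcases mul_eq_zero.1 this with h | h
      · exact absurd h (by positivity)
      · linarith
    exact ⟨g6, by rw [g6]; ring⟩
  rcases mul_eq_zero.1 e5 with h | h
  · rcases mul_eq_zero.1 h with h | h
    · have hxy : x = y := by linarith
      subst hxy
      obtain ⟨q1, q2⟩ := core x z (by linarith) (by linarith) (by linarith)
      exact Or.inr (Or.inr ⟨q1, q1, q2⟩)
    · have hyz : y = z := by linarith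
      subst hyz
      obtain ⟨q1, q2⟩ := core y x (by linarith) (by linarith) (by linarith)
      exact Or.inl ⟨q2, q1, q1⟩
  · have hzx : z = x := by linarith
    subst hzx
    obtain ⟨q1, q2⟩ := core z y (by linarith) (by linarith) (by linarith)
    exact Or.inr (Or.inl ⟨q1, q2, q1⟩)

theorem bulk_nonneg_eq {a b c : ℝ} (ha : 0 ≤ a) (hb : 0 < b) (hc : 0 < c) {Q : M3}
    (hQ : Q ∈ S0) : 0 ≤ fbulk a b c Q ∧ (fbulk a b c Q = 0 → Q ∈ Nman a b c) := by
  obtain ⟨U, l, hQU, hU1, hU2⟩ := diag_symm hQ.1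
  have hQQ : Q * Q = U * diagonal (fun i => l i * l i) * Uᵀ := by
    rw [← diagonal_mul_diagonal]
    calc Q * Q = U * diagonal l * (Uᵀ * U) * diagonal l * Uᵀ := by
          conv_lhs => rw [hQU]
          simp only [Matrix.mul_assoc]
      _ = _ := by rw [hU2, Matrix.mul_one]; simp only [Matrix.mul_assoc]
  have hQQQ : Q * Q * Q = U * diagonal (fun i => l i * l i * l i) * Uᵀ := by
    rw [← diagonal_mul_diagonal, hQQ]
    calc _ = U * diagonal (fun i => l i * l i) * (Uᵀ * U) * diagonal l * Uᵀ := by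
          conv_lhs => rw [hQU]
          simp only [Matrix.mul_assoc]
      _ = _ := by rw [hU2, Matrix.mul_one]; simp only [Matrix.mul_assoc]
  have htr : ∀ m : Fin 3 → ℝ, (U * diagonal m * Uᵀ).trace = m 0 + m 1 + m 2 := by
    intro m
    rw [Matrix.trace_mul_comm, ← Matrix.mul_assoc, hU2, Matrix.one_mul, Matrix.trace_diagonal,
      Fin.sum_univ_three]
  have h0 : l 0 + l 1 + l 2 = 0 := by
    have := hQ.2
    rwa [hQU, htr] at this
  have hs := sstar_pos (a := a) hb hc
  have hmain := bulk_eig ha hb hc hs (sstar_eq ha hc) (l 0) (l 1) (l 2) h0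
  have hfe : fbulk a b c Q = sstar a b c ^ 2 / 27 *
      (9 * a + 2 * b * sstar a b c - 3 * c * sstar a b c ^ 2)
      - a / 2 * (l 0 ^ 2 + l 1 ^ 2 + l 2 ^ 2) - b / 3 * (l 0 ^ 3 + l 1 ^ 3 + l 2 ^ 3)
      + c / 4 * (l 0 ^ 2 + l 1 ^ 2 + l 2 ^ 2) ^ 2 := by
    unfold fbulk kconst
    rw [hQQQ, hQQ, htr, htr]; ring
  rw [hfe]
  refine ⟨hmain.1, fun h => ?_⟩
  have hcase : ∃ i0 : Fin 3, ∀ i, l i = sstar a b c * (if i = i0 then 1 else 0)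
      - sstar a b c / 3 := by
    rcases hmain.2 h with ⟨h1, h2, h3⟩ | ⟨h1, h2, h3⟩ | ⟨h1, h2, h3⟩
    · refine ⟨0, fun i => ?_⟩
      fin_cases i <;> simp [h1, h2, h3] <;> ring
    · refine ⟨1, fun i => ?_⟩
      fin_cases i <;> simp [h1, h2, h3] <;> ring
    · refine ⟨2, fun i => ?_⟩
      fin_cases i <;> simp [h1, h2, h3] <;> ring
  obtain ⟨i0, hi0⟩ := hcase
  refine ⟨fun i => U i i0, ?_, ?_⟩
  · have := congrFun (congrFun hU2 i0) i0
    simpa [Matrix.mul_apply, sq] using this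
  · have hl : diagonal l = sstar a b c • diagonal (fun i => if i = i0 then (1:ℝ) else 0)
        - (sstar a b c / 3) • (1 : M3) := by
      ext i j
      by_cases hij : i = j
      · subst hij; simp [hi0]
      · simp [hij]
    have h1 : Q = sstar a b c • (U * diagonal (fun i => if i = i0 then (1:ℝ) else 0) * Uᵀ)
        - (sstar a b c / 3) • (1 : M3) := by
      rw [hQU, hl, Matrix.mul_sub, Matrix.sub_mul]
      simp [hU1]
    rw [h1]
    have h2 : U * diagonal (fun i => if i = i0 then (1:ℝ) else 0) * Uᵀ
        = Matrix.vecMulVec (fun i => U i i0) (fun i => U i i0) := by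
      ext i j
      rw [Matrix.mul_apply]
      simp only [Matrix.mul_diagonal]
      simp [Matrix.vecMulVec_apply]
    rw [h2, smul_sub, smul_smul]
    congr 2
    ring

theorem frobSq_nonneg (A : M3) : 0 ≤ frobSq A := by unfold frobSq; positivity

theorem entry_le_frob (A : M3) (i j : Fin 3) : |A i j| ≤ frobNorm A := by
  apply Real.abs_le_sqrt
  unfold frobSq
  calc (A i j) ^ 2 ≤ ∑ j, (A i j) ^ 2 :=
        Finset.single_le_sum (f := fun j => (A i j) ^ 2) (fun _ _ => sq_nonneg _)
          (Finset.mem_univ j)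
    _ ≤ _ := Finset.single_le_sum (f := fun i => ∑ j, (A i j) ^ 2)
          (fun _ _ => Finset.sum_nonneg fun _ _ => sq_nonneg _) (Finset.mem_univ i)

theorem continuous_frobNorm : Continuous frobNorm := by
  unfold frobNorm frobSq
  fun_prop

theorem continuous_fbulk (a b c : ℝ) : Continuous (fbulk a b c) := by
  unfold fbulk
  fun_prop

theorem bulk_gap {a b c : ℝ} (ha : 0 ≤ a) (hb : 0 < b) (hc : 0 < c) (M : ℝ) {δ : ℝ}
    (hδ : 0 < δ) : ∃ c0 > 0, ∀ Q ∈ S0, frobNorm Q ≤ M →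
      (∀ P ∈ Nman a b c, δ ≤ frobNorm (Q - P)) → c0 ≤ fbulk a b c Q := by
  set K : Set M3 := {Q | Q ∈ S0 ∧ frobNorm Q ≤ M ∧ ∀ P ∈ Nman a b c, δ ≤ frobNorm (Q - P)} with hK
  have hKcl : IsClosed K := by
    have h1 : IsClosed {Q : M3 | Qᵀ = Q} := isClosed_eq (by fun_prop) (by fun_prop)
    have h2 : IsClosed {Q : M3 | Q.trace = 0} := isClosed_eq (by fun_prop) (by fun_prop)
    have h3 : IsClosed {Q : M3 | frobNorm Q ≤ M} :=
      isClosed_le continuous_frobNorm continuous_const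
    have h4 : IsClosed (⋂ P ∈ Nman a b c, {Q : M3 | δ ≤ frobNorm (Q - P)}) := by
      refine isClosed_biInter fun P _ => isClosed_le continuous_const ?_
      exact continuous_frobNorm.comp (continuous_id.sub continuous_const)
    have : K = ({Q : M3 | Qᵀ = Q} ∩ {Q : M3 | Q.trace = 0}) ∩ ({Q : M3 | frobNorm Q ≤ M} ∩
        (⋂ P ∈ Nman a b c, {Q : M3 | δ ≤ frobNorm (Q - P)})) := by
      ext Q
      simp [hK, S0, Matrix.IsSymm]
    rw [this]
    exact (h1.inter h2).inter (h3.inter h4)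
  have hKc : IsCompact K := by
    have hbox : IsCompact (Set.pi univ fun _ : Fin 3 => Set.pi univ fun _ : Fin 3 => Icc (-M) M) :=
      isCompact_univ_pi fun _ => isCompact_univ_pi fun _ => isCompact_Icc
    refine IsCompact.of_isClosed_subset (s := (Set.pi univ fun _ : Fin 3 => Set.pi univ
      fun _ : Fin 3 => Icc (-M) M : Set M3)) hbox hKcl ?_
    intro Q hQ i _ j _
    exact abs_le.1 ((entry_le_frob Q i j).trans hQ.2.1)
  rcases K.eq_empty_or_nonempty with he | hne
  · refine ⟨1, one_pos, fun Q h1 h2 h3 => ?_⟩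
    have : Q ∈ K := ⟨h1, h2, h3⟩
    rw [he] at this; exact absurd this (notMem_empty _)
  · obtain ⟨Q0, hQ0, hmin⟩ := hKc.exists_isMinOn hne (continuous_fbulk a b c).continuousOn
    refine ⟨fbulk a b c Q0, ?_, fun Q h1 h2 h3 => hmin (show Q ∈ K from ⟨h1, h2, h3⟩)⟩
    obtain ⟨g1, g2⟩ := bulk_nonneg_eq ha hb hc hQ0.1
    refine lt_of_le_of_ne g1 fun h => ?_
    have := hQ0.2.2 Q0 (g2 h.symm)
    simp [frobNorm, frobSq] at this
    linarith

end

section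

open Filter Topology

/-- first variation of the bulk potential -/
def gB (a b c : ℝ) (B Q : M3) : ℝ :=
  -a * (Q * B).trace - b * (Q * Q * B).trace + c * (Q * Q).trace * (Q * B).trace

def h2B (a b c : ℝ) (B Q : M3) : ℝ :=
  -(a / 2) * (B * B).trace - b * (Q * B * B).trace
    + c / 4 * (4 * (Q * B).trace ^ 2 + 2 * (Q * Q).trace * (B * B).trace)

def h3B (b c : ℝ) (B Q : M3) : ℝ :=
  -(b / 3) * (B * B * B).trace + c * (Q * B).trace * (B * B).trace

def h4B (c : ℝ) (B : M3) : ℝ := c / 4 * (B * B).trace ^ 2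

theorem trace_sq_expand (Q B : M3) (τ : ℝ) : ((Q + τ • B) * (Q + τ • B)).trace
    = (Q * Q).trace + 2 * τ * (Q * B).trace + τ ^ 2 * (B * B).trace := by
  simp only [Matrix.add_mul, Matrix.mul_add, Matrix.smul_mul, Matrix.mul_smul, Matrix.trace_add,
    Matrix.trace_smul, smul_eq_mul]
  rw [Matrix.trace_mul_comm B Q]; ring

theorem trace_cube_expand (Q B : M3) (τ : ℝ) :
    ((Q + τ • B) * (Q + τ • B) * (Q + τ • B)).trace
    = (Q * Q * Q).trace + 3 * τ * (Q * Q * B).trace + 3 * τ ^ 2 * (Q * B * B).trace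
      + τ ^ 3 * (B * B * B).trace := by
  simp only [Matrix.add_mul, Matrix.mul_add, Matrix.smul_mul, Matrix.mul_smul, Matrix.trace_add,
    Matrix.trace_smul, smul_eq_mul]
  have e1 : (Q * B * Q).trace = (Q * Q * B).trace := by
    rw [Matrix.trace_mul_comm, ← Matrix.mul_assoc]
  have e2 : (B * Q * Q).trace = (Q * Q * B).trace := by
    rw [Matrix.mul_assoc, Matrix.trace_mul_comm]
  have e3 : (B * Q * B).trace = (Q * B * B).trace := by
    rw [Matrix.mul_assoc, Matrix.trace_mul_comm]
  have e4 : (B * B * Q).trace = (Q * B * B).trace := by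
    rw [Matrix.trace_mul_comm, ← Matrix.mul_assoc]
  rw [e1, e2, e3, e4]; ring

theorem fbulk_expand (a b c : ℝ) (Q B : M3) (τ : ℝ) :
    fbulk a b c (Q + τ • B) = fbulk a b c Q + τ * gB a b c B Q + τ ^ 2 * h2B a b c B Q
      + τ ^ 3 * h3B b c B Q + τ ^ 4 * h4B c B := by
  unfold fbulk gB h2B h3B h4B
  rw [trace_sq_expand, trace_cube_expand]; ring

theorem continuous_gB (a b c : ℝ) (B : M3) : Continuous (gB a b c B) := by
  unfold gB; fun_prop

theorem continuous_h2B (a b c : ℝ) (B : M3) : Continuous (h2B a b c B) := by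
  unfold h2B; fun_prop

theorem continuous_h3B (b c : ℝ) (B : M3) : Continuous (h3B b c B) := by
  unfold h3B; fun_prop

theorem poly_crit {I1 I2 I3 I4 : ℝ}
    (h : ∀ t : ℝ, 0 ≤ t * I1 + t ^ 2 * I2 + t ^ 3 * I3 + t ^ 4 * I4) : I1 = 0 := by
  have hd : HasDerivAt (fun t : ℝ => t * I1 + t ^ 2 * I2 + t ^ 3 * I3 + t ^ 4 * I4) I1 0 := by
    refine HasDerivAt.congr_deriv (((((hasDerivAt_id' (0:ℝ)).mul_const I1).fun_add
      ((hasDerivAt_pow 2 (0:ℝ)).mul_const I2)).fun_add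
      ((hasDerivAt_pow 3 (0:ℝ)).mul_const I3)).fun_add
      ((hasDerivAt_pow 4 (0:ℝ)).mul_const I4)) ?_
    simp
  refine IsLocalMin.hasDerivAt_eq_zero (Filter.Eventually.of_forall fun t => ?_) hd
  simpa using h t

theorem entry_contDiffOn {Ω : Set E3} {Q : E3 → M3} {n : WithTop ℕ∞} (hQ : ContDiffOn ℝ n Q Ω)
    (i j : Fin 3) : ContDiffOn ℝ n (fun y => Q y i j) Ω :=
  contDiffOn_pi.1 (contDiffOn_pi.1 hQ i) j

theorem contDiffOn_of_entry {Ω : Set E3} {Q : E3 → M3} {n : WithTop ℕ∞}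
    (hQ : ∀ i j, ContDiffOn ℝ n (fun y => Q y i j) Ω) : ContDiffOn ℝ n Q Ω :=
  contDiffOn_pi.2 fun i => contDiffOn_pi.2 fun j => hQ i j

/-- scalar component of `Q` along `B` -/
def qcomp (B : M3) (Q : E3 → M3) (y : E3) : ℝ := ∑ i, ∑ j, B i j * Q y i j

theorem qcomp_contDiffOn {Ω : Set E3} {Q : E3 → M3} {n : WithTop ℕ∞} (hQ : ContDiffOn ℝ n Q Ω)
    (B : M3) : ContDiffOn ℝ n (qcomp B Q) Ω :=
  ContDiffOn.sum fun i _ => ContDiffOn.sum fun j _ => contDiffOn_const.mul (entry_contDiffOn hQ i j)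

theorem Dk_qcomp {Q : E3 → M3} (B : M3) (k : Fin 3) {y : E3}
    (hQ : ∀ i j, DifferentiableAt ℝ (fun y => Q y i j) y) :
    Dk k (qcomp B Q) y = ∑ i, ∑ j, B i j * pd Q k y i j := by
  have hd : DifferentiableAt ℝ (qcomp B Q) y := by
    unfold qcomp
    exact DifferentiableAt.fun_sum fun i _ => DifferentiableAt.fun_sum fun j _ =>
      (hQ i j).const_mul _
  refine Dk_eq hd ?_
  unfold qcomp
  refine HasDerivAt.fun_sum fun i _ => HasDerivAt.fun_sum fun j _ => ?_
  exact (Dk_line (hQ i j)).const_mul (B i j)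

theorem pd_perturb {Q : E3 → M3} (B : M3) (t : ℝ) (φ : E3 → ℝ) (k : Fin 3) {y : E3}
    (hQ : ∀ i j, DifferentiableAt ℝ (fun y => Q y i j) y) (hφ : DifferentiableAt ℝ φ y) :
    ∀ i j, pd (fun y => Q y + (t * φ y) • B) k y i j = pd Q k y i j + t * Dk k φ y * B i j := by
  intro i j
  show Dk k (fun y => (Q y + (t * φ y) • B) i j) y = Dk k (fun y => Q y i j) y + _
  simp only [Matrix.add_apply, Matrix.smul_apply, smul_eq_mul]
  refine Dk_eq ((hQ i j).fun_add ((hφ.const_mul t).mul_const _)) ?_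
  exact (Dk_line (hQ i j)).fun_add (((Dk_line hφ).const_mul t).mul_const _)

theorem eDen_perturb (a b c ε : ℝ) {Q : E3 → M3} (B : M3) (t : ℝ) (φ : E3 → ℝ) {y : E3}
    (hQ : ∀ i j, DifferentiableAt ℝ (fun y => Q y i j) y) (hφ : DifferentiableAt ℝ φ y) :
    eDen a b c ε (fun y => Q y + (t * φ y) • B) y = eDen a b c ε Q y
      + t * (∑ k, Dk k φ y * Dk k (qcomp B Q) y + φ y * (1 / ε ^ 2 * gB a b c B (Q y)))
      + t ^ 2 * (1 / 2 * ((∑ k, Dk k φ y ^ 2) * frobSq B)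
          + φ y ^ 2 * (1 / ε ^ 2 * h2B a b c B (Q y)))
      + t ^ 3 * (φ y ^ 3 * (1 / ε ^ 2 * h3B b c B (Q y)))
      + t ^ 4 * (φ y ^ 4 * (1 / ε ^ 2 * h4B c B)) := by
  have hg : gradSq (fun y => Q y + (t * φ y) • B) y = gradSq Q y
      + 2 * t * ∑ k, Dk k φ y * Dk k (qcomp B Q) y
      + t ^ 2 * ((∑ k, Dk k φ y ^ 2) * frobSq B) := by
    unfold gradSq
    rw [Finset.sum_mul, Finset.mul_sum, Finset.mul_sum, ← Finset.sum_add_distrib,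
      ← Finset.sum_add_distrib]
    refine Finset.sum_congr rfl fun k _ => ?_
    rw [Dk_qcomp B k hQ]
    unfold frobSq
    simp only [pd_perturb B t φ k hQ hφ, Finset.mul_sum, ← Finset.sum_add_distrib]
    refine Finset.sum_congr rfl fun i _ => Finset.sum_congr rfl fun j _ => ?_
    ring
  unfold eDen
  rw [hg]
  show _ + 1 / ε ^ 2 * fbulk a b c (Q y + (t * φ y) • B) = _
  rw [fbulk_expand]
  ring

theorem eDen_continuousOn {a b c ε : ℝ} {Ω : Set E3} (hΩ : IsOpen Ω) {Q : E3 → M3}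
    (hQ : ContDiffOn ℝ 1 Q Ω) : ContinuousOn (eDen a b c ε Q) Ω := by
  unfold eDen gradSq frobSq
  refine ContinuousOn.add (continuousOn_const.mul ?_) (continuousOn_const.mul ?_)
  · refine continuousOn_finsetSum _ fun k _ => continuousOn_finsetSum _ fun i _ =>
      continuousOn_finsetSum _ fun j _ => ContinuousOn.pow ?_ 2
    exact (contDiffOn_Dk hΩ k (m := 0) (by simp) (entry_contDiffOn hQ i j)).continuousOn
  · exact (continuous_fbulk a b c).comp_continuousOn hQ.continuousOn

theorem intOn_ball {Ω : Set E3} {f : E3 → ℝ} (hf : ContinuousOn f Ω) {z : E3} {s : ℝ}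
    (h : closedBall z s ⊆ Ω) : IntegrableOn f (ball z s) :=
  ((hf.mono h).integrableOn_compact (isCompact_closedBall z s)).mono_set ball_subset_closedBall

theorem integral_poly {μ : Measure E3} {f0 f1 f2 f3 f4 : E3 → ℝ} {t : ℝ} (i0 : Integrable f0 μ)
    (i1 : Integrable f1 μ) (i2 : Integrable f2 μ) (i3 : Integrable f3 μ) (i4 : Integrable f4 μ) :
    ∫ y, (f0 y + t * f1 y + t ^ 2 * f2 y + t ^ 3 * f3 y + t ^ 4 * f4 y) ∂μ
      = ∫ y, f0 y ∂μ + t * ∫ y, f1 y ∂μ + t ^ 2 * ∫ y, f2 y ∂μ + t ^ 3 * ∫ y, f3 y ∂μ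
        + t ^ 4 * ∫ y, f4 y ∂μ := by
  have j1 : Integrable (fun y => f0 y + t * f1 y) μ := i0.add (i1.const_mul t)
  have j2 : Integrable (fun y => f0 y + t * f1 y + t ^ 2 * f2 y) μ := j1.add (i2.const_mul _)
  have j3 : Integrable (fun y => f0 y + t * f1 y + t ^ 2 * f2 y + t ^ 3 * f3 y) μ :=
    j2.add (i3.const_mul _)
  rw [integral_add j3 (i4.const_mul _), integral_add j2 (i3.const_mul _),
    integral_add j1 (i2.const_mul _), integral_add i0 (i1.const_mul _)]
  simp only [integral_const_mul]

theorem first_variation {a b c ε : ℝ} {Ω : Set E3} (hΩ : IsOpen Ω) {Q : E3 → M3}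
    (hQ : ContDiffOn ℝ (⊤ : ℕ∞) Q Ω) (hS : ∀ y ∈ Ω, Q y ∈ S0) (hmin : IsLDGMin a b c ε Ω Q)
    {B : M3} (hB : B ∈ S0) {z : E3} {s : ℝ} (hs : 0 < s) (hball : closedBall z s ⊆ Ω)
    {φ : E3 → ℝ} (hφ : ContDiff ℝ (⊤ : ℕ∞) φ) (hc : HasCompactSupport φ)
    (hsupp : tsupport φ ⊆ ball z s) :
    ∫ y in ball z s, (∑ k, Dk k φ y * Dk k (qcomp B Q) y + φ y * (1 / ε ^ 2 * gB a b c B (Q y)))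
      = 0 := by
  have hQ1 : ContDiffOn ℝ 1 Q Ω := hQ.of_le (by exact_mod_cast le_top)
  have hφ1 : ContDiff ℝ 1 φ := hφ.of_le (by exact_mod_cast le_top)
  have hQc := hQ1.continuousOn
  have hφc : ContinuousOn φ Ω := hφ1.continuous.continuousOn
  have hDφ : ∀ k, ContinuousOn (Dk k φ) Ω := fun k =>
    (contDiffOn_Dk hΩ k (m := 0) (by simp) hφ1.contDiffOn).continuousOn
  have hDu : ∀ k, ContinuousOn (Dk k (qcomp B Q)) Ω := fun k =>
    (contDiffOn_Dk hΩ k (m := 0) (by simp) (qcomp_contDiffOn hQ1 B)).continuousOn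
  have hgc : ContinuousOn (fun y => gB a b c B (Q y)) Ω := (continuous_gB a b c B).comp_continuousOn hQc
  have h2c : ContinuousOn (fun y => h2B a b c B (Q y)) Ω := (continuous_h2B a b c B).comp_continuousOn hQc
  have h3c : ContinuousOn (fun y => h3B b c B (Q y)) Ω := (continuous_h3B b c B).comp_continuousOn hQc
  have i0 := intOn_ball (eDen_continuousOn (a := a) (b := b) (c := c) (ε := ε) hΩ hQ1) hball
  have i1 : IntegrableOn (fun y => ∑ k, Dk k φ y * Dk k (qcomp B Q) y
      + φ y * (1 / ε ^ 2 * gB a b c B (Q y))) (ball z s) := intOn_ball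
    ((continuousOn_finsetSum _ fun k _ => (hDφ k).mul (hDu k)).add
      (hφc.mul (continuousOn_const.mul hgc))) hball
  have i2 : IntegrableOn (fun y => 1 / 2 * ((∑ k, Dk k φ y ^ 2) * frobSq B)
          + φ y ^ 2 * (1 / ε ^ 2 * h2B a b c B (Q y))) (ball z s) := intOn_ball
    ((continuousOn_const.mul ((continuousOn_finsetSum _ fun k _ => (hDφ k).pow 2).mul
      continuousOn_const)).add
      ((hφc.pow 2).mul (continuousOn_const.mul h2c))) hball
  have i3 : IntegrableOn (fun y => φ y ^ 3 * (1 / ε ^ 2 * h3B b c B (Q y))) (ball z s) :=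
    intOn_ball ((hφc.pow 3).mul (continuousOn_const.mul h3c)) hball
  have i4 : IntegrableOn (fun y => φ y ^ 4 * (1 / ε ^ 2 * h4B c B)) (ball z s) :=
    intOn_ball ((hφc.pow 4).mul continuousOn_const) hball
  refine poly_crit (I2 := ∫ y in ball z s, (1 / 2 * ((∑ k, Dk k φ y ^ 2) * frobSq B)
          + φ y ^ 2 * (1 / ε ^ 2 * h2B a b c B (Q y))))
    (I3 := ∫ y in ball z s, φ y ^ 3 * (1 / ε ^ 2 * h3B b c B (Q y)))
    (I4 := ∫ y in ball z s, φ y ^ 4 * (1 / ε ^ 2 * h4B c B)) fun t => ?_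
  have hle := hmin z s hs hball (fun y => Q y + (t * φ y) • B) ?_ ?_
    ⟨tsupport φ, hc, hsupp, fun y hy => ?_⟩
  · unfold energy at hle
    have heq : ∫ y in ball z s, eDen a b c ε (fun y => Q y + (t * φ y) • B) y
        = ∫ y in ball z s, (eDen a b c ε Q y
      + t * (∑ k, Dk k φ y * Dk k (qcomp B Q) y + φ y * (1 / ε ^ 2 * gB a b c B (Q y)))
      + t ^ 2 * (1 / 2 * ((∑ k, Dk k φ y ^ 2) * frobSq B)
          + φ y ^ 2 * (1 / ε ^ 2 * h2B a b c B (Q y)))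
      + t ^ 3 * (φ y ^ 3 * (1 / ε ^ 2 * h3B b c B (Q y)))
      + t ^ 4 * (φ y ^ 4 * (1 / ε ^ 2 * h4B c B))) := by
      refine setIntegral_congr_fun measurableSet_ball fun y hy => ?_
      have hyΩ := hball (ball_subset_closedBall hy)
      exact eDen_perturb a b c ε B t φ (fun i j =>
        ((entry_contDiffOn hQ1 i j).contDiffAt (hΩ.mem_nhds hyΩ)).differentiableAt (by norm_num))
        (hφ1.contDiffAt.differentiableAt (by norm_num))
    rw [heq, integral_poly i0 i1 i2 i3 i4] at hle
    linarith
  · refine contDiffOn_of_entry fun i j => ?_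
    simp only [Matrix.add_apply, Matrix.smul_apply, smul_eq_mul]
    exact (entry_contDiffOn hQ i j).add
      ((contDiffOn_const.mul hφ.contDiffOn).mul contDiffOn_const)
  · intro y hy
    refine ⟨?_, ?_⟩
    · exact (hS y hy).1.add (hB.1.smul _)
    · rw [Matrix.trace_add, Matrix.trace_smul, (hS y hy).2, hB.2]; simp
  · simp [image_eq_zero_of_notMem_tsupport hy]

theorem EL {a b c ε : ℝ} {Ω : Set E3} (hΩ : IsOpen Ω) {Q : E3 → M3}
    (hQ : ContDiffOn ℝ (⊤ : ℕ∞) Q Ω) (hS : ∀ y ∈ Ω, Q y ∈ S0) (hmin : IsLDGMin a b c ε Ω Q)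
    {B : M3} (hB : B ∈ S0) {z : E3} (hz : z ∈ Ω) :
    lap (qcomp B Q) z = 1 / ε ^ 2 * gB a b c B (Q z) := by
  obtain ⟨s, hs, hball⟩ := Metric.nhds_basis_closedBall.mem_iff.1 (hΩ.mem_nhds hz)
  have hQ2 : ContDiffOn ℝ 2 Q Ω := by exact_mod_cast contDiffOn_infty.1 hQ 2
  have hu2 := qcomp_contDiffOn hQ2 B
  have hDu : ∀ k, ContDiffOn ℝ 1 (Dk k (qcomp B Q)) Ω := fun k =>
    contDiffOn_Dk hΩ k (by norm_num) hu2
  have hDDu : ∀ k, ContinuousOn (Dk k (Dk k (qcomp B Q))) Ω := fun k =>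
    (contDiffOn_Dk hΩ k (m := 0) (by simp) (hDu k)).continuousOn
  have hlapc : ContinuousOn (lap (qcomp B Q)) Ω := continuousOn_finsetSum _ fun k _ => hDDu k
  have hgc : ContinuousOn (fun y => 1 / ε ^ 2 * gB a b c B (Q y)) Ω :=
    continuousOn_const.mul ((continuous_gB a b c B).comp_continuousOn hQ2.continuousOn)
  have hsub : ball z s ⊆ Ω := ball_subset_closedBall.trans hball
  set f : E3 → ℝ := fun y => 1 / ε ^ 2 * gB a b c B (Q y) - lap (qcomp B Q) y with hf
  have hfc : ContinuousOn f Ω := hgc.sub hlapc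
  have hae : ∀ᵐ y, y ∈ ball z s → f y = 0 := by
    refine isOpen_ball.ae_eq_zero_of_integral_contDiff_smul_eq_zero
      (intOn_ball hfc hball).locallyIntegrableOn ?_
    intro φ hφ hc hsupp
    have hφ1 : ContDiff ℝ 1 φ := hφ.of_le (by exact_mod_cast le_top)
    have h1 := first_variation hΩ hQ hS hmin hB hs hball hφ hc hsupp
    have h2 := fun k => integral_Dk_cutoff hΩ k hφ1 (hsupp.trans hsub) hc (hDu k)
    have h3 : ∀ k, ∫ y in ball z s, Dk k (fun y => φ y * Dk k (qcomp B Q) y) y = 0 := by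
      intro k
      rw [setIntegral_eq_integral_of_forall_compl_eq_zero, (h2 k).2]
      intro y hy
      exact Dk_cutoff_zero k fun h => hy (hsupp h)
    have h4 : ∫ y in ball z s, ∑ k, Dk k (fun y => φ y * Dk k (qcomp B Q) y) y = 0 := by
      rw [integral_finsetSum _ fun k _ => (h2 k).1.integrableOn]
      simp [h3]
    have hDφ : ∀ k, ContinuousOn (Dk k φ) Ω := fun k =>
      (contDiffOn_Dk hΩ k (m := 0) (by simp) hφ1.contDiffOn).continuousOn
    have i1 : IntegrableOn (fun y => ∑ k, Dk k φ y * Dk k (qcomp B Q) y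
      + φ y * (1 / ε ^ 2 * gB a b c B (Q y))) (ball z s) := intOn_ball
      ((continuousOn_finsetSum _ fun k _ => (hDφ k).mul (hDu k).continuousOn).add
      (hφ1.continuous.continuousOn.mul hgc)) hball
    have i2 : IntegrableOn (fun y => ∑ k, Dk k (fun y => φ y * Dk k (qcomp B Q) y) y) (ball z s) :=
      integrable_finsetSum _ fun k _ => (h2 k).1.integrableOn
    have h5 := integral_sub i1 i2
    rw [h1, h4, sub_zero] at h5
    rw [← setIntegral_eq_integral_of_forall_compl_eq_zero (s := ball z s), ← h5]
    · refine setIntegral_congr_fun measurableSet_ball fun y hy => ?_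
      have hn := hΩ.mem_nhds (hsub hy)
      have hd : ∀ k, Dk k (fun y => φ y * Dk k (qcomp B Q) y) y
          = Dk k φ y * Dk k (qcomp B Q) y + φ y * Dk k (Dk k (qcomp B Q)) y := by
        intro k
        have d1 : DifferentiableAt ℝ φ y := hφ1.contDiffAt.differentiableAt (by norm_num)
        have d2 : DifferentiableAt ℝ (Dk k (qcomp B Q)) y :=
          ((hDu k).contDiffAt hn).differentiableAt (by norm_num)
        refine Dk_eq (d1.fun_mul d2) (HasDerivAt.congr_deriv ((Dk_line d1).fun_mul (Dk_line d2)) ?_)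
        simp
      simp only [hd, hf, smul_eq_mul, Finset.sum_add_distrib, ← Finset.mul_sum, lap]
      ring
    · intro y hy
      rw [image_eq_zero_of_notMem_tsupport fun h => hy (hsupp h)]; simp
  have hz' : EqOn f (fun _ => 0) (ball z s) := by
    refine MeasureTheory.Measure.eqOn_open_of_ae_eq (μ := volume) ?_ isOpen_ball (hfc.mono hsub)
      continuousOn_const
    exact (ae_restrict_iff' measurableSet_ball).2 hae
  have := hz' (mem_ball_self hs)
  simp only [hf] at this
  linarith

end

section

open Filter Topology

theorem frobNorm_eq (A : M3) : frobNorm A =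
    ‖(WithLp.toLp 2 (fun p : Fin 3 × Fin 3 => A p.1 p.2) : EuclideanSpace ℝ (Fin 3 × Fin 3))‖ := by
  rw [EuclideanSpace.norm_eq]
  simp [frobNorm, frobSq, Fintype.sum_prod_type]

theorem frobNorm_tri (A B C : M3) : frobNorm (A - C) ≤ frobNorm (B - A) + frobNorm (B - C) := by
  rw [frobNorm_eq, frobNorm_eq, frobNorm_eq]
  have e : (WithLp.toLp 2 (fun p : Fin 3 × Fin 3 => (A - C) p.1 p.2) :
      EuclideanSpace ℝ (Fin 3 × Fin 3)) =
      -(WithLp.toLp 2 (fun p : Fin 3 × Fin 3 => (B - A) p.1 p.2)) +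
      WithLp.toLp 2 (fun p : Fin 3 × Fin 3 => (B - C) p.1 p.2) := by
    ext p; simp
  rw [e]
  exact (norm_add_le _ _).trans (by rw [norm_neg])

theorem contDiff_fbulk (a b c : ℝ) {n : WithTop ℕ∞} : ContDiff ℝ n (fbulk a b c) := by
  have h : ∀ i j, ContDiff ℝ n (fun Q : M3 => Q i j) := fun i j =>
    contDiff_apply_apply ℝ ℝ i j
  have h2 : ContDiff ℝ n (fun Q : M3 => (Q * Q).trace) := by
    simp only [Matrix.trace, Matrix.mul_apply, Matrix.diag]
    exact ContDiff.sum fun i _ => ContDiff.sum fun j _ => (h i j).mul (h j i)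
  have h3 : ContDiff ℝ n (fun Q : M3 => (Q * Q * Q).trace) := by
    simp only [Matrix.trace, Matrix.mul_apply, Matrix.diag]
    exact ContDiff.sum fun i _ => ContDiff.sum fun j _ =>
      (ContDiff.sum fun k _ => (h i k).mul (h k j)).mul (h j i)
  unfold fbulk
  exact ((contDiff_const.sub (contDiff_const.mul h2)).sub (contDiff_const.mul h3)).add
    (contDiff_const.mul (h2.pow 2))

theorem fderiv_fbulk (a b c : ℝ) (Q B : M3) : fderiv ℝ (fbulk a b c) Q B = gB a b c B Q := by
  have hd : HasFDerivAt (fbulk a b c) (fderiv ℝ (fbulk a b c) Q) Q :=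
    ((contDiff_fbulk a b c (n := 1)).differentiable (by norm_num) Q).hasFDerivAt
  have h1 : HasDerivAt (fun τ : ℝ => Q + τ • B) B 0 := by
    refine HasDerivAt.congr_deriv (((hasDerivAt_id' (0:ℝ)).smul_const B).const_add Q) ?_
    simp
  have h2 : HasDerivAt (fun τ : ℝ => fbulk a b c (Q + τ • B)) (fderiv ℝ (fbulk a b c) Q B) 0 := by
    have hd' : HasFDerivAt (fbulk a b c) (fderiv ℝ (fbulk a b c) Q)
        ((fun τ : ℝ => Q + τ • B) 0) := by simpa using hd
    exact hd'.comp_hasDerivAt (0:ℝ) h1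
  have h3 : HasDerivAt (fun τ : ℝ => fbulk a b c (Q + τ • B)) (gB a b c B Q) 0 := by
    simp only [fbulk_expand]
    refine HasDerivAt.congr_deriv ((((((hasDerivAt_id' (0:ℝ)).mul_const
      (gB a b c B Q)).const_add (fbulk a b c Q)).fun_add
      ((hasDerivAt_pow 2 (0:ℝ)).mul_const (h2B a b c B Q))).fun_add
      ((hasDerivAt_pow 3 (0:ℝ)).mul_const (h3B b c B Q))).fun_add
      ((hasDerivAt_pow 4 (0:ℝ)).mul_const (h4B c B))) ?_
    simp
  exact h2.unique h3

theorem Dk_fbulk {a b c : ℝ} {Q : E3 → M3} (k : Fin 3) {y : E3}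
    (hQd : DifferentiableAt ℝ Q y) (hQ : ∀ i j, DifferentiableAt ℝ (fun y => Q y i j) y) :
    Dk k (fun y => fbulk a b c (Q y)) y = gB a b c (pd Q k y) (Q y) := by
  have hdiff : DifferentiableAt ℝ (fbulk a b c) (Q y) :=
    (contDiff_fbulk a b c (n := 1)).differentiable (by norm_num) (Q y)
  refine Dk_eq (hdiff.comp y hQd) ?_
  rw [← fderiv_fbulk]
  have h1 : HasDerivAt (fun s : ℝ => Q (y + s • EuclideanSpace.single k (1:ℝ))) (pd Q k y) 0 := by
    refine hasDerivAt_pi.2 fun i => hasDerivAt_pi.2 fun j => ?_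
    exact Dk_line (hQ i j)
  have hd' : HasFDerivAt (fbulk a b c) (fderiv ℝ (fbulk a b c) (Q y))
      ((fun s : ℝ => Q (y + s • EuclideanSpace.single k (1:ℝ))) 0) := by
    simpa using hdiff.hasFDerivAt
  exact hd'.comp_hasDerivAt (0:ℝ) h1

theorem pd_mem_S0 {Ω : Set E3} (hΩ : IsOpen Ω) {Q : E3 → M3} (hS : ∀ y ∈ Ω, Q y ∈ S0)
    (k : Fin 3) {y : E3} (hy : y ∈ Ω) (hQ : ∀ i j, DifferentiableAt ℝ (fun y => Q y i j) y) :
    pd Q k y ∈ S0 := by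
  have hn := hΩ.mem_nhds hy
  constructor
  · ext i j
    show Dk k (fun y => Q y j i) y = Dk k (fun y => Q y i j) y
    unfold Dk
    rw [Filter.EventuallyEq.fderiv_eq]
    filter_upwards [hn] with w hw
    exact (hS w hw).1.apply i j
  · have h1 : Dk k (qcomp 1 Q) y = 0 := by
      unfold Dk
      rw [Filter.EventuallyEq.fderiv_eq (f := fun _ => (0:ℝ))]
      · simp
      · filter_upwards [hn] with w hw
        have := (hS w hw).2
        simpa [qcomp, Matrix.trace, Matrix.one_apply] using this
    rw [Dk_qcomp 1 k hQ] at h1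
    simpa [Matrix.trace, Matrix.one_apply] using h1

theorem lap_qcomp {Ω : Set E3} (hΩ : IsOpen Ω) {Q : E3 → M3} (hQ : ContDiffOn ℝ 2 Q Ω) (B : M3)
    {y : E3} (hy : y ∈ Ω) :
    lap (qcomp B Q) y = ∑ i, ∑ j, B i j * lap (fun y => Q y i j) y := by
  have hn := hΩ.mem_nhds hy
  have key : ∀ k, Dk k (Dk k (qcomp B Q)) y
      = ∑ i, ∑ j, B i j * Dk k (Dk k (fun y => Q y i j)) y := by
    intro k
    have e : Dk k (qcomp B Q) =ᶠ[𝓝 y] qcomp B (pd Q k) := by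
      filter_upwards [hn] with w hw
      exact Dk_qcomp B k fun i j => ((entry_contDiffOn hQ i j).contDiffAt
        (hΩ.mem_nhds hw)).differentiableAt (by norm_num)
    have e2 : Dk k (Dk k (qcomp B Q)) y = Dk k (qcomp B (pd Q k)) y := by
      unfold Dk at e ⊢
      rw [Filter.EventuallyEq.fderiv_eq e]
    rw [e2, Dk_qcomp B k]
    · rfl
    · intro i j
      exact ((contDiffOn_Dk hΩ k (m := 1) (by norm_num) (entry_contDiffOn hQ i j)).contDiffAt
        hn).differentiableAt (by norm_num)
  unfold lap
  simp only [key, Finset.mul_sum]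
  rw [Finset.sum_comm]
  exact Finset.sum_congr rfl fun i _ => Finset.sum_comm

theorem eDen_eq (a b c ε : ℝ) (Q : E3 → M3) (y : E3) : eDen a b c ε Q y =
    1 / 2 * ∑ α : Fin 3 × Fin 3, gsq (fun y => Q y α.1 α.2) y + 1 / ε ^ 2 * fbulk a b c (Q y) := by
  unfold eDen gradSq frobSq gsq
  rw [Fintype.sum_prod_type]
  congr 2
  rw [Finset.sum_comm]
  refine Finset.sum_congr rfl fun i _ => ?_
  rw [Finset.sum_comm]
  rfl

theorem exists_bounds (a b c M : ℝ) : ∃ C1 C2 : ℝ, 0 ≤ C1 ∧ 0 ≤ C2 ∧ ∀ B Q : M3,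
    (∀ i j, |B i j| ≤ 2 * M) → (∀ i j, |Q i j| ≤ M) →
    |∑ i, ∑ j, B i j * Q i j| ≤ C1 ∧ |gB a b c B Q| ≤ C2 := by
  have hbox : ∀ L : ℝ, IsCompact (Set.pi univ fun _ : Fin 3 => Set.pi univ
      fun _ : Fin 3 => Icc (-L) L : Set M3) := fun L =>
    isCompact_univ_pi (X := fun _ : Fin 3 => Fin 3 → ℝ)
      fun _ => isCompact_univ_pi fun _ => isCompact_Icc
  have hc := (hbox (2 * M)).prod (hbox M)
  have f1 : Continuous (fun p : M3 × M3 => ∑ i, ∑ j, p.1 i j * p.2 i j) := by fun_prop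
  have f2 : Continuous (fun p : M3 × M3 => gB a b c p.1 p.2) := by unfold gB; fun_prop
  obtain ⟨C1, h1⟩ := hc.exists_bound_of_continuousOn f1.continuousOn
  obtain ⟨C2, h2⟩ := hc.exists_bound_of_continuousOn f2.continuousOn
  refine ⟨max C1 0, max C2 0, le_max_right _ _, le_max_right _ _, fun B Q hB hQ => ?_⟩
  have hm : (B, Q) ∈ (Set.pi univ fun _ : Fin 3 => Set.pi univ
      fun _ : Fin 3 => Icc (-(2 * M)) (2 * M) : Set M3) ×ˢ (Set.pi univ fun _ : Fin 3 => Set.pi univ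
      fun _ : Fin 3 => Icc (-M) M : Set M3) :=
    ⟨fun i _ j _ => abs_le.1 (hB i j), fun i _ j _ => abs_le.1 (hQ i j)⟩
  exact ⟨(h1 _ hm).trans (le_max_left _ _), (h2 _ hm).trans (le_max_left _ _)⟩

theorem main_aux (a b c : ℝ) (ha : 0 ≤ a) (hb : 0 < b) (hc : 0 < c)
    (M δ : ℝ) (hδ : 0 < δ) :
    ∃ η Λ : ℝ, 0 < η ∧ 0 < Λ ∧
      ∀ ε ∈ Ioo (0 : ℝ) 1, ∀ (x : E3) (r : ℝ), Λ * ε < r → r < 1 →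
        ∀ Q : E3 → M3,
          ContDiffOn ℝ (⊤ : ℕ∞) Q (ball x (4 * r)) →
          (∀ y ∈ ball x (4 * r), Q y ∈ S0) →
          IsLDGMin a b c ε (ball x (4 * r)) Q →
          (∀ y ∈ ball x (4 * r), frobNorm (Q y) ≤ M) →
          r⁻¹ * energy a b c ε Q (ball x (2 * r)) < η →
          ∀ y ∈ ball x r, distN a b c (Q y) < δ := by
  obtain ⟨c0, hc0, hgap⟩ := bulk_gap ha hb hc M (half_pos hδ)
  obtain ⟨C1, C2, hC1, hC2, hbd⟩ := exists_bounds a b c M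
  set K : ℝ := 3 * (3 * C1 + (C2 + 1) / 2) with hK
  have hK0 : 0 < K := by positivity
  set κ : ℝ := min 1 ((δ / 2) ^ 2 / K) with hκ
  have hκ0 : 0 < κ := lt_min one_pos (by positivity)
  have hκ1 : κ ≤ 1 := min_le_left _ _
  have hκK : K * κ ≤ (δ / 2) ^ 2 := by
    have : κ ≤ (δ / 2) ^ 2 / K := min_le_right _ _
    rw [le_div_iff₀ hK0] at this; linarith
  set v1 : ℝ := volume.real (ball (0 : E3) 1) with hv1
  have hv0 : 0 < v1 := by
    rw [hv1]
    exact ENNReal.toReal_pos (measure_ball_pos volume _ one_pos).ne' measure_ball_lt_top.ne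
  refine ⟨3 / 64 * κ ^ 2 * c0 * v1, 4, by positivity, by norm_num, ?_⟩
  intro ε hε x r hεr _ Q hQ hS hmin hQM hE z hz
  by_contra hcon
  push Not at hcon
  have hε0 := hε.1
  have hr : 0 < r := by linarith
  set Ω := ball x (4 * r) with hΩd
  have hΩ : IsOpen Ω := isOpen_ball
  have hzx : dist z x < r := hz
  have hQ2 : ContDiffOn ℝ 2 Q Ω := by exact_mod_cast contDiffOn_infty.1 hQ 2
  have hQ1 : ContDiffOn ℝ 1 Q Ω := hQ2.of_le (by norm_num)
  have hzΩ : z ∈ Ω := by rw [hΩd, mem_ball]; linarith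
  have hfar : ∀ P ∈ Nman a b c, δ ≤ frobNorm (Q z - P) := by
    intro P hP
    refine hcon.trans (csInf_le ⟨0, ?_⟩ ⟨P, hP, rfl⟩)
    rintro _ ⟨P, _, rfl⟩
    exact Real.sqrt_nonneg _
  have hent : ∀ y ∈ Ω, ∀ i j, |Q y i j| ≤ M := fun y hy i j =>
    (entry_le_frob _ i j).trans (hQM y hy)
  have hsubε : closedBall z (4 * ε) ⊆ Ω := by
    intro y hy
    rw [mem_closedBall] at hy
    rw [hΩd, mem_ball]
    linarith [dist_triangle y z x]
  -- closeness on a small ball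
  have hκε : κ * ε ≤ ε := by nlinarith
  have hsmall : ball z (κ * ε) ⊆ closedBall z (4 * ε) := by
    intro y hy
    rw [mem_ball] at hy
    rw [mem_closedBall]; linarith
  have hclose : ∀ y ∈ ball z (κ * ε), frobNorm (Q y - Q z) ≤ δ / 2 := by
    intro y hy
    have hyΩ : y ∈ Ω := hsubε (hsmall hy)
    rw [mem_ball] at hy
    have hBS : Q y - Q z ∈ S0 := by
      refine ⟨(hS y hyΩ).1.sub (hS z hzΩ).1, ?_⟩
      rw [Matrix.trace_sub, (hS z hzΩ).2, (hS y hyΩ).2, sub_zero]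
    have hBe : ∀ i j, |(Q y - Q z) i j| ≤ 2 * M := by
      intro i j
      rw [Matrix.sub_apply]
      have h1 := hent z hzΩ i j
      have h2 := hent y hyΩ i j
      have := abs_sub (Q y i j) (Q z i j)
      linarith
    have hl := lip_estimate (N := (C2 + 1) / ε ^ 2) hΩ (qcomp_contDiffOn hQ2 (Q y - Q z)) hε0 hC1
      hsubε (fun w hw => (hbd _ _ hBe (hent w (hsubε hw))).1) (fun w hw => by
        rw [EL hΩ hQ hS hmin hBS (hsubε hw), abs_mul, abs_of_pos (by positivity), div_mul_eq_mul_div,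
          one_mul]
        have := (hbd _ _ hBe (hent w (hsubε hw))).2
        gcongr
        linarith) y (by linarith)
    have hsq : frobSq (Q y - Q z) = qcomp (Q y - Q z) Q y - qcomp (Q y - Q z) Q z := by
      unfold frobSq qcomp
      rw [← Finset.sum_sub_distrib]
      refine Finset.sum_congr rfl fun i _ => ?_
      rw [← Finset.sum_sub_distrib]
      refine Finset.sum_congr rfl fun j _ => ?_
      rw [Matrix.sub_apply]; ring
    have hcoef : 3 * (3 * C1 / ε + (C2 + 1) / ε ^ 2 * ε / 2) = K / ε := by
      rw [hK]; field_simp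
    rw [hcoef, ← hsq] at hl
    have h1 : K / ε * dist y z ≤ K / ε * (κ * ε) := by gcongr
    have h2 : K / ε * (κ * ε) = K * κ := by field_simp
    refine Real.sqrt_le_iff.2 ⟨by linarith, ?_⟩
    linarith [le_abs_self (frobSq (Q y - Q z))]
  have hlow : ∀ y ∈ ball z (κ * ε), c0 ≤ fbulk a b c (Q y) := by
    intro y hy
    have hyΩ : y ∈ Ω := hsubε (hsmall hy)
    refine hgap _ (hS y hyΩ) (hQM y hyΩ) fun P hP => ?_
    have h1 := hfar P hP
    have h2 := hclose y hy
    have h3 := frobNorm_tri (Q z) (Q y) P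
    linarith
  have hdiff : ∀ y ∈ Ω, ∀ i j, DifferentiableAt ℝ (fun y => Q y i j) y := fun y hy i j =>
    ((entry_contDiffOn hQ1 i j).contDiffAt (hΩ.mem_nhds hy)).differentiableAt (by norm_num)
  have hF1 : ContDiffOn ℝ 1 (fun y => fbulk a b c (Q y)) Ω :=
    (contDiff_fbulk a b c).comp_contDiffOn hQ1
  have hsubr : closedBall z r ⊆ ball x (2 * r) := by
    intro y hy
    rw [mem_closedBall] at hy
    rw [mem_ball]
    linarith [dist_triangle y z x]
  have hsub2 : closedBall x (2 * r) ⊆ Ω := closedBall_subset_ball (by linarith)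
  have hmono := monotone_energy hΩ (fun (α : Fin 3 × Fin 3) y => Q y α.1 α.2)
    (fun y => 1 / ε ^ 2 * fbulk a b c (Q y)) (fun α => entry_contDiffOn hQ2 α.1 α.2)
    (contDiffOn_const.mul hF1)
    (fun y hy => mul_nonneg (by positivity) (bulk_nonneg_eq ha hb hc (hS y hy)).1)
    (by
      intro y hy k
      have hn := hΩ.mem_nhds hy
      have hpd := pd_mem_S0 hΩ hS k hy (hdiff y hy)
      have e1 : Dk k (fun y => 1 / ε ^ 2 * fbulk a b c (Q y)) y
          = 1 / ε ^ 2 * gB a b c (pd Q k y) (Q y) := by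
        have hd := (hF1.contDiffAt hn).differentiableAt (by norm_num)
        refine Dk_eq (hd.const_mul _) ?_
        rw [← Dk_fbulk k ((hQ1.contDiffAt hn).differentiableAt (by norm_num)) (hdiff y hy)]
        exact (Dk_line hd).const_mul _
      rw [e1, ← EL hΩ hQ hS hmin hpd hy, lap_qcomp hΩ hQ2 _ hy, Fintype.sum_prod_type]
      refine Finset.sum_congr rfl fun i _ => Finset.sum_congr rfl fun j _ => ?_
      rw [mul_comm]; rfl)
    z r (κ * ε) (by positivity) (by linarith)
    (hsubr.trans (ball_subset_closedBall.trans hsub2))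
  simp only [← eDen_eq] at hmono
  have hec : ContinuousOn (eDen a b c ε Q) Ω := eDen_continuousOn hΩ hQ1
  have he0 : ∀ y ∈ Ω, 0 ≤ eDen a b c ε Q y := by
    intro y hy
    unfold eDen gradSq
    have h1 := (bulk_nonneg_eq ha hb hc (hS y hy)).1
    have h2 : 0 ≤ ∑ k, frobSq (pd Q k y) := Finset.sum_nonneg fun k _ => frobSq_nonneg _
    positivity
  have hup : ∫ y in closedBall z r, eDen a b c ε Q y ≤ energy a b c ε Q (ball x (2 * r)) := by
    refine setIntegral_mono_set (intOn_ball hec hsub2) ?_ hsubr.eventuallyLE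
    exact (ae_restrict_iff' measurableSet_ball).2
      (Filter.Eventually.of_forall fun y hy => he0 y (hsub2 (ball_subset_closedBall hy)))
  have hdn : c0 / ε ^ 2 * ((κ * ε) ^ 3 * v1) ≤ ∫ y in ball z (κ * ε), eDen a b c ε Q y := by
    have hvol : volume.real (ball z (κ * ε)) = (κ * ε) ^ 3 * v1 := by
      rw [Measure.real, Measure.addHaar_ball _ _ (by positivity : (0:ℝ) ≤ κ * ε), ENNReal.toReal_mul,
        ENNReal.toReal_ofReal (by positivity)]
      simp [hv1, Measure.real]
    have hcst : ∫ _y in ball z (κ * ε), c0 / ε ^ 2 = c0 / ε ^ 2 * ((κ * ε) ^ 3 * v1) := by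
      rw [setIntegral_const, hvol, smul_eq_mul, mul_comm]
    rw [← hcst]
    refine setIntegral_mono_on ?_ ?_ measurableSet_ball fun y hy => ?_
    · exact integrableOn_const measure_ball_lt_top.ne
    · exact ((hec.mono hsubε).integrableOn_compact (isCompact_closedBall _ _)).mono_set hsmall
    · have h1 := hlow y hy
      unfold eDen gradSq
      have h2 : 0 ≤ ∑ k, frobSq (pd Q k y) := Finset.sum_nonneg fun k _ => frobSq_nonneg _
      have h3 : c0 / ε ^ 2 ≤ 1 / ε ^ 2 * fbulk a b c (Q y) := by
        rw [div_mul_eq_mul_div, one_mul]; gcongr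
      linarith
  have g1 : 3 / (16 * (κ * ε)) * (c0 / ε ^ 2 * ((κ * ε) ^ 3 * v1)) = 3 / 16 * κ ^ 2 * c0 * v1 := by
    field_simp
  have g2 : 3 / (16 * (κ * ε)) * (c0 / ε ^ 2 * ((κ * ε) ^ 3 * v1)) ≤
      3 / (16 * (κ * ε)) * ∫ y in ball z (κ * ε), eDen a b c ε Q y := by gcongr
  have g3 : 4 / r * ∫ y in closedBall z r, eDen a b c ε Q y
      ≤ 4 / r * energy a b c ε Q (ball x (2 * r)) := by gcongr
  have g4 : 4 / r * energy a b c ε Q (ball x (2 * r))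
      = 4 * (r⁻¹ * energy a b c ε Q (ball x (2 * r))) := by
    rw [div_eq_mul_inv]; ring
  linarith

end

/-- small energy implies closeness to the vacuum manifold. -/
theorem stmt5 (a b c : ℝ) (ha : 0 ≤ a) (hb : 0 < b) (hc : 0 < c)
    (M δ : ℝ) (hM : 0 < M) (hδ : 0 < δ) :
    ∃ η Λ : ℝ, 0 < η ∧ 0 < Λ ∧
      ∀ ε ∈ Ioo (0 : ℝ) 1, ∀ (x : E3) (r : ℝ), Λ * ε < r → r < 1 →
        ∀ Q : E3 → M3,
          ContDiffOn ℝ (⊤ : ℕ∞) Q (ball x (4 * r)) →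
          (∀ y ∈ ball x (4 * r), Q y ∈ S0) →
          IsLDGMin a b c ε (ball x (4 * r)) Q →
          (∀ y ∈ ball x (4 * r), frobNorm (Q y) ≤ M) →
          r⁻¹ * energy a b c ε Q (ball x (2 * r)) < η →
          ∀ y ∈ ball x r, distN a b c (Q y) < δ :=
  main_aux a b c ha hb hc M δ hδ

end
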